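/- arXiv:1103.5361 — 3 statements merged into one kernel-verified Lean document; each statement's English description precedes it below -/
import Mathlib

section
/- Let Λ be an artin algebra with radical J and e a basic primitive idempotent such that eΛe/eJ²e is commutative. If the simple module S_e = eΛ/eJ has finite projective dimension, then Ext¹_Λ(S_e, S_e) = 0. -/
universe u

/-- The commutator subgroup [R,R]: additive subgroup generated by ab - ba. -/
def commSub (R : Type*) [Ring R] : AddSubgroup R :=
  AddSubgroup.closure {x | ∃ a b : R, x = a * b - b * a}

/-- The quotient ring Λ_e = Λ/Λ(1-e)Λ. -/
abbrev corner (Λ : Type*) [Ring Λ] (e : Λ) :=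
  (TwoSidedIdeal.span {1 - e}).ringCon.Quotient

/-- The canonical projection Λ → Λ_e. -/
abbrev cornerProj (Λ : Type*) [Ring Λ] (e : Λ) : Λ →+* corner Λ e :=
  (TwoSidedIdeal.span {1 - e}).ringCon.mk'

/-- The Jacobson radical of Λ, via the classical characterization:
x ∈ J(Λ) iff 1 - yx is invertible for every y. -/
def Jset (Λ : Type*) [Ring Λ] : Set Λ := {x | ∀ y : Λ, IsUnit (1 - y * x)}

/-- The square J² of the Jacobson radical, as an additive subgroup. -/
def Jsq (Λ : Type*) [Ring Λ] : AddSubgroup Λ :=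
  AddSubgroup.closure {x | ∃ a ∈ Jset Λ, ∃ b ∈ Jset Λ, x = a * b}

/-- The right ideal eΛ as a Λᵐᵒᵖ-submodule of Λ. -/
def eSub (Λ : Type*) [Ring Λ] (e : Λ) : Submodule Λᵐᵒᵖ Λ where
  carrier := {x | e * x = x}
  add_mem' := by intro x y hx hy; simp only [Set.mem_setOf_eq] at *; rw [mul_add, hx, hy]
  zero_mem' := by simp
  smul_mem' := by
    intro c x hx
    simp only [Set.mem_setOf_eq, MulOpposite.smul_eq_mul_unop, ← mul_assoc] at *
    rw [hx]

/-- The semisimple right Λ-module S_e = eΛ/eJ. -/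
abbrev SeMod (Λ : Type*) [Ring Λ] (e : Λ) :=
  (eSub Λ e) ⧸ (Submodule.span Λᵐᵒᵖ {x : eSub Λ e | (x : Λ) ∈ Jset Λ})

/-- A right Λ-module M has finite injective dimension: it admits a finite injective
coresolution 0 → M → I⁰ → I¹ → ⋯ with Iⁱ = 0 for all large i. -/
def FinInjDim (Λ : Type u) [Ring Λ] (M : Type u) [AddCommGroup M] [Module Λᵐᵒᵖ M] : Prop :=
  ∃ (I : ℕ → ModuleCat.{u} Λᵐᵒᵖ) (f : ∀ i, I i →ₗ[Λᵐᵒᵖ] I (i+1)) (g : M →ₗ[Λᵐᵒᵖ] I 0),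
    (∀ i, Module.Injective Λᵐᵒᵖ (I i)) ∧ Function.Injective g ∧
    LinearMap.ker (f 0) = LinearMap.range g ∧
    (∀ i, LinearMap.ker (f (i+1)) = LinearMap.range (f i)) ∧
    ∃ N, ∀ i ≥ N, Subsingleton (I i)

/-- A right Λ-module M has finite projective dimension: it admits a finite projective
resolution ⋯ → P₁ → P₀ → M → 0 with Pᵢ = 0 for all large i. -/
def FinProjDim (Λ : Type u) [Ring Λ] (M : Type u) [AddCommGroup M] [Module Λᵐᵒᵖ M] : Prop :=
  ∃ (P : ℕ → ModuleCat.{u} Λᵐᵒᵖ) (f : ∀ i, P (i+1) →ₗ[Λᵐᵒᵖ] P i) (g : P 0 →ₗ[Λᵐᵒᵖ] M),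
    (∀ i, Module.Projective Λᵐᵒᵖ (P i)) ∧ Function.Surjective g ∧
    LinearMap.ker g = LinearMap.range (f 0) ∧
    (∀ i, LinearMap.ker (f i) = LinearMap.range (f (i+1))) ∧
    ∃ N, ∀ i ≥ N, Subsingleton (P i)

/-- Ext¹_Λ(S,S) = 0, expressed as: every short exact sequence 0 → S → E → S → 0 of right
Λ-modules splits. -/
def Ext1SelfVanishes (Λ : Type u) [Ring Λ] (S : Type u) [AddCommGroup S]
    [Module Λᵐᵒᵖ S] : Prop :=
  ∀ (E : Type u) [AddCommGroup E] [Module Λᵐᵒᵖ E]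
    (i : S →ₗ[Λᵐᵒᵖ] E) (p : E →ₗ[Λᵐᵒᵖ] S),
    Function.Injective i → Function.Surjective p → LinearMap.ker p = LinearMap.range i →
    ∃ r : E →ₗ[Λᵐᵒᵖ] S, ∀ x, r (i x) = x

/-- An idempotent u is primitive if it is nonzero and is not the sum of two orthogonal
nonzero idempotents. -/
def IsPrimitiveIdem {Λ : Type*} [Ring Λ] (u : Λ) : Prop :=
  u ≠ 0 ∧ IsIdempotentElem u ∧ ∀ f g : Λ, IsIdempotentElem f → IsIdempotentElem g →
    f * g = 0 → g * f = 0 → f + g = u → f = 0 ∨ g = 0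

/-- A primitive idempotent e is basic if eΛ is not isomorphic to a direct summand of
(1-e)Λ; equivalently, there are no u ∈ eΛ(1-e), v ∈ (1-e)Λe with uv = e. -/
def IsBasicIdem {Λ : Type*} [Ring Λ] (e : Λ) : Prop :=
  IsPrimitiveIdem e ∧
    ¬ ∃ u v : Λ, u = e * u * (1 - e) ∧ v = (1 - e) * v * e ∧ u * v = e


namespace SNL
open CategoryTheory Abelian

/-- The character dual of a left module. -/
def Dual (M : Type u) [AddCommGroup M] : Type u := M →+ AddCircle (1 : ℚ)

section dual
variable {Λ : Type u} [Ring Λ] {M : Type u} [AddCommGroup M] [Module Λ M]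

instance : AddCommGroup (Dual M) := inferInstanceAs (AddCommGroup (M →+ AddCircle (1 : ℚ)))
instance : FunLike (Dual M) M (AddCircle (1 : ℚ)) :=
  inferInstanceAs (FunLike (M →+ AddCircle (1 : ℚ)) M (AddCircle (1 : ℚ)))
instance : AddMonoidHomClass (Dual M) M (AddCircle (1 : ℚ)) :=
  inferInstanceAs (AddMonoidHomClass (M →+ AddCircle (1 : ℚ)) M (AddCircle (1 : ℚ)))

theorem Dual.ext {f g : Dual M} (h : ∀ x, f x = g x) : f = g := DFunLike.ext _ _ h

theorem Dual.add_apply (f g : Dual M) (x : M) : (f + g) x = f x + g x := rfl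
theorem Dual.zero_apply (x : M) : (0 : Dual M) x = 0 := rfl

instance : Module Λᵐᵒᵖ (Dual M) where
  smul c f := AddMonoidHom.comp (f : M →+ AddCircle (1 : ℚ)) (DistribSMul.toAddMonoidHom M c.unop)
  one_smul f := Dual.ext fun x => by
    change f ((1 : Λᵐᵒᵖ).unop • x) = f x
    simp
  mul_smul c d f := Dual.ext fun x => by
    change f ((c * d).unop • x) = f (d.unop • c.unop • x)
    simp [mul_smul]
  smul_zero c := rfl
  smul_add c f g := rfl
  add_smul c d f := Dual.ext fun x => by
    change f ((c + d).unop • x) = f (c.unop • x) + f (d.unop • x)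
    simp [add_smul]
  zero_smul f := Dual.ext fun x => by
    change f ((0 : Λᵐᵒᵖ).unop • x) = 0
    simp

theorem Dual.smul_apply (c : Λᵐᵒᵖ) (f : Dual M) (x : M) : (c • f) x = f (c.unop • x) := rfl

variable {N : Type u} [AddCommGroup N] [Module Λ N]

/-- The transpose of a linear map. -/
def Dual.map (f : M →ₗ[Λ] N) : Dual N →ₗ[Λᵐᵒᵖ] Dual M where
  toFun g := AddMonoidHom.comp (g : N →+ AddCircle (1 : ℚ)) f.toAddMonoidHom
  map_add' _ _ := rfl
  map_smul' c g := Dual.ext fun x => by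
    change g (c.unop • f x) = g (f (c.unop • x))
    simp

theorem Dual.map_apply (f : M →ₗ[Λ] N) (g : Dual N) (x : M) : Dual.map f g x = g (f x) := rfl

/-- extension of characters -/
theorem exists_ext_char {A B : Type u} [AddCommGroup A] [AddCommGroup B] (i : A →+ B)
    (hi : Function.Injective i) (f : A →+ AddCircle (1 : ℚ)) :
    ∃ g : B →+ AddCircle (1 : ℚ), ∀ x, g (i x) = f x := by
  obtain ⟨g, hg⟩ := CharacterModule.dual_surjective_of_injective i.toIntLinearMap hi
    (f : CharacterModule A)
  exact ⟨g, fun x => DFunLike.congr_fun hg x⟩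

/-- an additive map through which all characters factor is injective. -/
theorem injective_of_char {A B : Type*} [AddCommGroup A] [AddCommGroup B] (i : A →+ B)
    (h : ∀ f : A →+ AddCircle (1 : ℚ), ∃ g : B →+ AddCircle (1 : ℚ), ∀ x, g (i x) = f x) :
    Function.Injective i := by
  rw [injective_iff_map_eq_zero]
  intro a ha
  apply CharacterModule.eq_zero_of_character_apply
  intro c
  obtain ⟨g, hg⟩ := h c
  have := hg a
  rw [ha, map_zero] at this
  exact this.symm

theorem Dual.map_surjective (f : M →ₗ[Λ] N) (hf : Function.Injective f) :
    Function.Surjective (Dual.map f) := fun g => by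
  obtain ⟨h, hh⟩ := exists_ext_char f.toAddMonoidHom hf g
  exact ⟨h, Dual.ext hh⟩

theorem Dual.map_injective (f : M →ₗ[Λ] N) (hf : Function.Surjective f) :
    Function.Injective (Dual.map f) := fun g h hgh => by
  refine Dual.ext fun x => ?_
  obtain ⟨y, rfl⟩ := hf x
  exact DFunLike.congr_fun hgh y

theorem Dual.exact {C : Type u} [AddCommGroup C] [Module Λ C] (i : M →ₗ[Λ] N) (p : N →ₗ[Λ] C)
    (hp : Function.Surjective p) (h : Function.Exact i p) :
    Function.Exact (Dual.map p) (Dual.map i) := by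
  intro g
  constructor
  · intro hg
    have h0 : ∀ x, p x = 0 → g x = 0 := by
      intro x hx
      obtain ⟨y, rfl⟩ := (h x).1 hx
      exact DFunLike.congr_fun hg y
    have hp' : Function.Surjective p.toAddMonoidHom := hp
    refine ⟨AddMonoidHom.liftOfSurjective p.toAddMonoidHom hp' ⟨g, fun x hx => h0 x hx⟩, ?_⟩
    refine Dual.ext fun x => ?_
    exact AddMonoidHom.liftOfRightInverse_comp_apply _ _ (Function.rightInverse_surjInv hp') _ _
  · rintro ⟨f, rfl⟩
    refine Dual.ext fun x => ?_
    rw [Dual.map_apply, Dual.map_apply, h.apply_apply_eq_zero]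
    simp [Dual.zero_apply]

theorem Dual.injective_free (ι : Type) [Fintype ι] :
    Module.Injective Λᵐᵒᵖ (Dual (ι → Λ)) := by
  classical
  constructor
  intro X Y _ _ _ _ f hf g
  let χ : ι → X →+ AddCircle (1 : ℚ) := fun i =>
    { toFun := fun x => g x (Pi.single i 1)
      map_zero' := by rw [map_zero]; rfl
      map_add' := fun x y => by rw [map_add]; rfl }
  choose χ' hχ' using fun i => exists_ext_char f.toAddMonoidHom hf (χ i)
  let G : Y →ₗ[Λᵐᵒᵖ] Dual (ι → Λ) :=
    { toFun := fun y =>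
        ({ toFun := fun v => ∑ i, χ' i (MulOpposite.op (v i) • y)
           map_zero' := by simp
           map_add' := fun v w => by simp [add_smul, Finset.sum_add_distrib] } :
          (ι → Λ) →+ AddCircle (1 : ℚ))
      map_add' := fun y z => Dual.ext fun v => by
        change ∑ i, χ' i (MulOpposite.op (v i) • (y + z)) =
          (∑ i, χ' i (MulOpposite.op (v i) • y)) + ∑ i, χ' i (MulOpposite.op (v i) • z)
        simp [Finset.sum_add_distrib]
      map_smul' := fun c y => Dual.ext fun v => by
        change ∑ i, χ' i (MulOpposite.op (v i) • c • y) =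
          ∑ i, χ' i (MulOpposite.op ((c.unop • v) i) • y)
        simp [smul_smul] }
  refine ⟨G, fun x => Dual.ext fun v => ?_⟩
  change ∑ i, χ' i (MulOpposite.op (v i) • f x) = g x v
  have h1 : ∀ i, χ' i (MulOpposite.op (v i) • f x) = g x (Pi.single i (v i)) := by
    intro i
    rw [← map_smul]
    refine (hχ' i _).trans ?_
    change g (MulOpposite.op (v i) • x) (Pi.single i 1) = _
    rw [map_smul, Dual.smul_apply]
    congr 1
    ext j
    by_cases h : j = i
    · subst h; simp
    · simp [h]
  rw [Finset.sum_congr rfl fun i _ => h1 i, ← map_sum]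
  congr 1
  exact Finset.univ_sum_single v

end dual

section ext
variable {Λ : Type u} [Ring Λ] (T : ModuleCat.{u} Λᵐᵒᵖ)

/-- `D T d M`: the groups `Ext^i(T, M^*)` vanish for `i > d`. -/
def TD (d : ℕ) (M : Type u) [AddCommGroup M] [Module Λ M] : Prop :=
  ∀ i, d < i → Subsingleton (Ext T (ModuleCat.of Λᵐᵒᵖ (Dual M)) i)

variable {A B C : Type u} [AddCommGroup A] [Module Λ A] [AddCommGroup B] [Module Λ B]
  [AddCommGroup C] [Module Λ C]

/-- the dual short complex -/
abbrev dualSC (i : A →ₗ[Λ] B) (p : B →ₗ[Λ] C) (h : Function.Exact i p) :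
    ShortComplex (ModuleCat.{u} Λᵐᵒᵖ) where
  X₁ := ModuleCat.of Λᵐᵒᵖ (Dual C)
  X₂ := ModuleCat.of Λᵐᵒᵖ (Dual B)
  X₃ := ModuleCat.of Λᵐᵒᵖ (Dual A)
  f := ModuleCat.ofHom (Dual.map p)
  g := ModuleCat.ofHom (Dual.map i)
  zero := by
    ext g
    refine Dual.ext fun x => ?_
    change g (p (i x)) = 0
    rw [h.apply_apply_eq_zero, map_zero]

theorem dualSC_shortExact (i : A →ₗ[Λ] B) (p : B →ₗ[Λ] C) (h : Function.Exact i p)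
    (hi : Function.Injective i) (hp : Function.Surjective p) : (dualSC i p h).ShortExact where
  exact := by
    rw [ShortComplex.ShortExact.moduleCat_exact_iff_function_exact]
    exact Dual.exact i p hp h
  mono_f := (ModuleCat.mono_iff_injective _).2 (Dual.map_injective p hp)
  epi_g := (ModuleCat.epi_iff_surjective _).2 (Dual.map_surjective i hi)

variable {T} {i : A →ₗ[Λ] B} {p : B →ₗ[Λ] C}

theorem TD.mid (h : Function.Exact i p)
    (hi : Function.Injective i) (hp : Function.Surjective p)
    {d : ℕ} (hA : TD T d A) (hC : TD T d C) : TD T d B := fun j hj => by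
  have := hA j hj
  have := hC j hj
  refine subsingleton_of_forall_eq 0 fun x => ?_
  obtain ⟨y, rfl⟩ := Ext.covariant_sequence_exact₂ T (dualSC_shortExact i p h hi hp)
    (x : Ext T (dualSC i p h).X₂ j) (Subsingleton.elim (α := Ext T (ModuleCat.of Λᵐᵒᵖ (Dual A)) j) _ _)
  rw [Subsingleton.elim (α := Ext T (ModuleCat.of Λᵐᵒᵖ (Dual C)) j) y 0]
  simp

theorem TD.syz (h : Function.Exact i p)
    (hi : Function.Injective i) (hp : Function.Surjective p)
    {d : ℕ} (hB : TD T 0 B) (hC : TD T (d + 1) C) : TD T d A := fun j hj => by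
  have := hB j (by omega)
  have := hC (j + 1) (by omega)
  refine subsingleton_of_forall_eq 0 fun x => ?_
  obtain ⟨y, rfl⟩ := Ext.covariant_sequence_exact₃ T (dualSC_shortExact i p h hi hp)
    (x : Ext T (dualSC i p h).X₃ j) rfl (Subsingleton.elim (α := Ext T (ModuleCat.of Λᵐᵒᵖ (Dual C)) (j + 1)) _ _)
  rw [Subsingleton.elim (α := Ext T (ModuleCat.of Λᵐᵒᵖ (Dual B)) j) y 0]
  simp

theorem TD.lift (h : Function.Exact i p)
    (hi : Function.Injective i) (hp : Function.Surjective p)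
    (hC : TD T 0 C) (f : T ⟶ ModuleCat.of Λᵐᵒᵖ (Dual A)) :
    ∃ g : T ⟶ ModuleCat.of Λᵐᵒᵖ (Dual B), g ≫ ModuleCat.ofHom (Dual.map i) = f := by
  have := hC 1 (by omega)
  obtain ⟨y, hy⟩ := Ext.covariant_sequence_exact₃ T (dualSC_shortExact i p h hi hp)
    (Ext.mk₀ f : Ext T (dualSC i p h).X₃ 0) (zero_add 1)
    (Subsingleton.elim (α := Ext T (ModuleCat.of Λᵐᵒᵖ (Dual C)) 1) _ _)
  obtain ⟨g, rfl⟩ := Ext.homEquiv₀.symm.surjective y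
  refine ⟨g, ?_⟩
  rw [Ext.homEquiv₀_symm_apply, Ext.mk₀_comp_mk₀] at hy
  exact Ext.homEquiv₀.symm.injective hy

theorem TD.free (ι : Type) [Fintype ι] : TD T 0 (ι → Λ) := fun j hj => by
  have := Dual.injective_free (Λ := Λ) ι
  have : Injective (ModuleCat.of Λᵐᵒᵖ (Dual (ι → Λ))) :=
    Module.injective_object_of_injective_module _ _
  obtain ⟨j, rfl⟩ : ∃ k, j = k + 1 := ⟨j - 1, by omega⟩
  exact subsingleton_of_forall_eq 0 Ext.eq_zero_of_injective

theorem TD.mono {d d' : ℕ} (hd : d ≤ d') (h : TD T d A) : TD T d' A :=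
  fun j hj => h j (by omega)

theorem TD.of_subsingleton [Subsingleton A] (d : ℕ) : TD T d A := fun j hj => by
  have : Subsingleton (Dual A) := ⟨fun f g => Dual.ext fun x => by
    rw [Subsingleton.elim x 0, map_zero, map_zero]⟩
  have : Module.Injective Λᵐᵒᵖ (Dual A) := ⟨fun X Y _ _ _ _ f hf g =>
    ⟨0, fun x => Subsingleton.elim _ _⟩⟩
  have : Injective (ModuleCat.of Λᵐᵒᵖ (Dual A)) :=
    Module.injective_object_of_injective_module _ _
  obtain ⟨j, rfl⟩ : ∃ k, j = k + 1 := ⟨j - 1, by omega⟩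
  exact subsingleton_of_forall_eq 0 Ext.eq_zero_of_injective
end ext
end SNL


namespace SNL
set_option linter.unusedSectionVars false
open CategoryTheory Abelian TensorProduct

section red
variable {Λ : Type u} [Ring Λ] {R : Type u} [CommRing R] (π : Λ →+* R) [RingHomSurjective π]

/-- The submodule `I M` for `I = ker π`. -/
def kerSub (M : Type u) [AddCommGroup M] [Module Λ M] : Submodule Λ M :=
  Submodule.span Λ {x | ∃ c m, π c = 0 ∧ x = c • m}

/-- `R ⊗_Λ M = M / I M`. -/
def Red (M : Type u) [AddCommGroup M] [Module Λ M] : Type u := M ⧸ kerSub π M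

variable (M : Type u) [AddCommGroup M] [Module Λ M]
  {N : Type u} [AddCommGroup N] [Module Λ N]
  {L : Type u} [AddCommGroup L] [Module Λ L]

instance : AddCommGroup (Red π M) := inferInstanceAs (AddCommGroup (M ⧸ kerSub π M))
instance : Module Λ (Red π M) := inferInstanceAs (Module Λ (M ⧸ kerSub π M))

/-- The projection. -/
def Red.mk : M →ₗ[Λ] Red π M := (kerSub π M).mkQ

theorem Red.mk_surjective : Function.Surjective (Red.mk π M) := (kerSub π M).mkQ_surjective

variable {M}

theorem Red.smul_eq_zero {c : Λ} (hc : π c = 0) (x : Red π M) : c • x = 0 := by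
  obtain ⟨m, rfl⟩ := Red.mk_surjective π M x
  rw [← map_smul]
  exact (Submodule.Quotient.mk_eq_zero _).2 (Submodule.subset_span ⟨c, m, hc, rfl⟩)

noncomputable instance : SMul R (Red π M) :=
  ⟨fun r x => Function.surjInv (RingHomSurjective.is_surjective (σ := π)) r • x⟩

theorem Red.map_smul' (c : Λ) (x : Red π M) : π c • x = c • x := by
  change Function.surjInv (RingHomSurjective.is_surjective (σ := π)) (π c) • x = c • x
  rw [← sub_eq_zero, ← sub_smul]
  apply Red.smul_eq_zero
  rw [map_sub, Function.surjInv_eq (RingHomSurjective.is_surjective (σ := π)), sub_self]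

noncomputable instance : Module R (Red π M) :=
  Function.Surjective.moduleLeft π RingHomSurjective.is_surjective (Red.map_smul' π)

/-- lifting additive maps -/
def Red.liftAdd {G : Type*} [AddCommGroup G] (f : M →+ G)
    (hf : ∀ c m, π c = 0 → f (c • m) = 0) : Red π M →+ G :=
  QuotientAddGroup.lift (kerSub π M).toAddSubgroup f (by
    intro x hx
    have : ∀ d : Λ, f (d • x) = 0 := by
      induction hx using Submodule.span_induction with
      | mem x h =>
        obtain ⟨c, m, hc, rfl⟩ := h
        intro d
        rw [smul_smul]
        exact hf _ _ (by rw [map_mul, hc, mul_zero])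
      | zero => simp
      | add x y _ _ hx hy => intro d; rw [smul_add, map_add, hx, hy, add_zero]
      | smul c x _ hx => intro d; rw [smul_smul, hx]
    simpa using this 1)

theorem Red.liftAdd_mk {G : Type*} [AddCommGroup G] (f : M →+ G)
    (hf : ∀ c m, π c = 0 → f (c • m) = 0) (m : M) :
    Red.liftAdd π f hf (Red.mk π M m) = f m := rfl

/-- functoriality -/
def Red.map (φ : M →ₗ[Λ] N) : Red π M →ₗ[R] Red π N where
  toFun := Red.liftAdd π ((Red.mk π N).comp φ).toAddMonoidHom (by
    intro c m hc
    change Red.mk π N (φ (c • m)) = 0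
    rw [map_smul, map_smul, Red.smul_eq_zero π hc])
  map_add' := map_add _
  map_smul' r x := by
    obtain ⟨m, rfl⟩ := Red.mk_surjective π M x
    obtain ⟨c, rfl⟩ := RingHomSurjective.is_surjective (σ := π) r
    rw [Red.map_smul', ← map_smul, Red.liftAdd_mk, Red.liftAdd_mk]
    change Red.mk π N (φ (c • m)) = π c • Red.mk π N (φ m)
    rw [Red.map_smul', map_smul, map_smul]

theorem Red.map_mk (φ : M →ₗ[Λ] N) (m : M) :
    Red.map π φ (Red.mk π M m) = Red.mk π N (φ m) := rfl

theorem Red.map_comp (φ : M →ₗ[Λ] N) (ψ : N →ₗ[Λ] L) :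
    Red.map π (ψ ∘ₗ φ) = Red.map π ψ ∘ₗ Red.map π φ := by
  ext x
  obtain ⟨m, rfl⟩ := Red.mk_surjective π M x
  rfl

theorem Red.map_zero : Red.map π (0 : M →ₗ[Λ] N) = 0 := by
  ext x
  obtain ⟨m, rfl⟩ := Red.mk_surjective π M x
  rw [Red.map_mk]
  simp

theorem Red.map_surjective (φ : M →ₗ[Λ] N) (hφ : Function.Surjective φ) :
    Function.Surjective (Red.map π φ) := fun y => by
  obtain ⟨n, rfl⟩ := Red.mk_surjective π N y
  obtain ⟨m, rfl⟩ := hφ n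
  exact ⟨Red.mk π M m, rfl⟩

theorem Red.map_exact (i : M →ₗ[Λ] N) (p : N →ₗ[Λ] L) (h : Function.Exact i p)
    (hp : Function.Surjective p) : Function.Exact (Red.map π i) (Red.map π p) := by
  intro y
  constructor
  · intro hy
    obtain ⟨n, rfl⟩ := Red.mk_surjective π N y
    rw [Red.map_mk] at hy
    have hy : p n ∈ kerSub π L := (Submodule.Quotient.mk_eq_zero _).1 hy
    have key : kerSub π L ≤ (kerSub π N).map p := by
      rw [kerSub, Submodule.span_le]
      rintro _ ⟨c, l, hc, rfl⟩
      obtain ⟨n, rfl⟩ := hp l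
      exact ⟨c • n, Submodule.subset_span ⟨c, n, hc, rfl⟩, map_smul _ _ _⟩
    obtain ⟨n', hn', e⟩ := key hy
    obtain ⟨m, hm⟩ := (h (n - n')).1 (by rw [map_sub, e, sub_self])
    refine ⟨Red.mk π M m, ?_⟩
    rw [Red.map_mk, hm, map_sub]
    have : Red.mk π N n' = 0 := (Submodule.Quotient.mk_eq_zero _).2 hn'
    rw [this, sub_zero]
  · rintro ⟨x, rfl⟩
    obtain ⟨m, rfl⟩ := Red.mk_surjective π M x
    rw [Red.map_mk, Red.map_mk, h.apply_apply_eq_zero, _root_.map_zero]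

instance [Module.Finite Λ M] : Module.Finite R (Red π M) := by
  obtain ⟨s, hs⟩ := Module.Finite.fg_top (R := Λ) (M := M)
  classical
  refine ⟨⟨s.image (Red.mk π M), ?_⟩⟩
  rw [eq_top_iff]
  rintro x -
  obtain ⟨m, rfl⟩ := Red.mk_surjective π M x
  have hm : m ∈ Submodule.span Λ (s : Set M) := hs ▸ Submodule.mem_top
  induction hm using Submodule.span_induction with
  | mem x h => exact Submodule.subset_span (by simpa using ⟨x, h, rfl⟩)
  | zero => simp
  | add x y _ _ hx hy => rw [map_add]; exact add_mem hx hy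
  | smul c x _ hx =>
    rw [map_smul, ← Red.map_smul' π]
    exact Submodule.smul_mem _ _ hx

variable (X : Type u) [AddCommGroup X] [Module R X]
/-- An `R`-module as a right `Λ`-module. -/
def Rt (_ : Λ →+* R) (X : Type u) : Type u := X

instance : AddCommGroup (Rt π X) := inferInstanceAs (AddCommGroup X)

/-- the identity map -/
def Rt.of : X ≃+ Rt π X := AddEquiv.refl X

/-- the homomorphism to `R` -/
def opHom : Λᵐᵒᵖ →+* R := π.fromOpposite fun _ _ => mul_comm _ _

instance : Module Λᵐᵒᵖ (Rt π X) := Module.compHom X (opHom π)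

variable {X}

theorem Rt.of_smul (c : Λ) (x : X) : Rt.of π X (π c • x) = MulOpposite.op c • Rt.of π X x := rfl

theorem Rt.op_smul (c : Λᵐᵒᵖ) (x : Rt π X) :
    c • x = Rt.of π X (π c.unop • (Rt.of π X).symm x) := rfl

/-- linear maps as maps of right modules. -/
def Rt.map {Y : Type u} [AddCommGroup Y] [Module R Y]
    (f : X →ₗ[R] Y) : Rt π X →ₗ[Λᵐᵒᵖ] Rt π Y where
  toFun x := Rt.of π Y (f ((Rt.of π X).symm x))
  map_add' x y := by simp
  map_smul' c x := by simp [Rt.op_smul]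

/-- The underlying additive map. -/
def Dual.hom (f : Dual M) : M →+ AddCircle (1 : ℚ) := f

theorem Dual.hom_apply (f : Dual M) (m : M) : Dual.hom f m = f m := rfl

/-- The dual element of an additive map. -/
def Dual.of (f : M →+ AddCircle (1 : ℚ)) : Dual M := f

theorem Dual.of_apply (f : M →+ AddCircle (1 : ℚ)) (m : M) : Dual.of f m = f m := rfl

theorem Rt.hom_smul (f : Rt π X →ₗ[Λᵐᵒᵖ] Dual M) (c : Λ) (x : X) (m : M) :
    Dual.hom (f (Rt.of π X (π c • x))) m = Dual.hom (f (Rt.of π X x)) (c • m) := by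
  rw [Rt.of_smul, f.map_smul]
  rfl

/-- The character on `X ⊗ R ⊗ M` of a homomorphism `X → M^*`. -/
noncomputable def charOfHom (f : Rt π X →ₗ[Λᵐᵒᵖ] Dual M) :
    X ⊗[R] Red π M →+ AddCircle (1 : ℚ) :=
  TensorProduct.liftAddHom
    { toFun := fun x => Red.liftAdd π (Dual.hom (f (Rt.of π X x))) (by
        intro c m hc
        rw [← Rt.hom_smul, hc, zero_smul, _root_.map_zero, _root_.map_zero]
        rfl)
      map_zero' := by
        ext z
        obtain ⟨m, rfl⟩ := Red.mk_surjective π M z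
        rw [AddMonoidHom.zero_apply, Red.liftAdd_mk, _root_.map_zero, _root_.map_zero]
        rfl
      map_add' := fun x y => by
        ext z
        obtain ⟨m, rfl⟩ := Red.mk_surjective π M z
        rw [AddMonoidHom.add_apply, Red.liftAdd_mk, Red.liftAdd_mk, Red.liftAdd_mk,
          map_add, map_add]
        rfl }
    (by
      intro r x z
      obtain ⟨m, rfl⟩ := Red.mk_surjective π M z
      obtain ⟨c, rfl⟩ := RingHomSurjective.is_surjective (σ := π) r
      rw [Red.map_smul', ← map_smul]
      exact Rt.hom_smul π f c x m)

theorem charOfHom_tmul (f : Rt π X →ₗ[Λᵐᵒᵖ] Dual M) (x : X) (m : M) :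
    charOfHom π f (x ⊗ₜ Red.mk π M m) = f (Rt.of π X x) m := rfl

/-- The converse. -/
noncomputable def homOfChar (χ : X ⊗[R] Red π M →+ AddCircle (1 : ℚ)) :
    Rt π X →ₗ[Λᵐᵒᵖ] Dual M where
  toFun := fun x => Dual.of {
        toFun := fun m => χ ((Rt.of π X).symm x ⊗ₜ Red.mk π M m)
        map_zero' := by simp
        map_add' := fun m n => by rw [map_add, tmul_add, map_add] }
  map_add' := fun x y => Dual.ext fun m => by
    rw [Dual.add_apply]
    simp only [Dual.of_apply, AddMonoidHom.coe_mk, ZeroHom.coe_mk]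
    rw [map_add, add_tmul, map_add]
  map_smul' := fun c x => Dual.ext fun m => by
    rw [RingHom.id_apply, Dual.smul_apply]
    simp only [Dual.of_apply, AddMonoidHom.coe_mk, ZeroHom.coe_mk]
    rw [(Red.mk π M).map_smul, ← Red.map_smul', ← smul_tmul, Rt.op_smul,
      AddEquiv.symm_apply_apply]

theorem homOfChar_apply (χ : X ⊗[R] Red π M →+ AddCircle (1 : ℚ)) (x : X) (m : M) :
    homOfChar π χ (Rt.of π X x) m = χ (x ⊗ₜ Red.mk π M m) := rfl

end red
end SNL


namespace SNL
set_option linter.unusedSectionVars false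
open CategoryTheory Abelian TensorProduct

/-- Additivity of the trace. -/
theorem trace_add {R A B C : Type*} [CommRing R] [AddCommGroup A] [Module R A] [AddCommGroup B]
    [Module R B] [AddCommGroup C] [Module R C] [Module.Free R A] [Module.Finite R A]
    [Module.Free R B] [Module.Finite R B] [Module.Free R C] [Module.Finite R C]
    (i : A →ₗ[R] B) (p : B →ₗ[R] C) (h : Function.Exact i p) (hp : Function.Surjective p)
    (r : B →ₗ[R] A) (hr : r ∘ₗ i = LinearMap.id)
    (a : A →ₗ[R] A) (b : B →ₗ[R] B) (c : C →ₗ[R] C) (hab : b ∘ₗ i = i ∘ₗ a)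
    (hbc : p ∘ₗ b = c ∘ₗ p) :
    LinearMap.trace R B b = LinearMap.trace R A a + LinearMap.trace R C c := by
  obtain ⟨s0, hs0⟩ := Module.projective_lifting_property p LinearMap.id hp
  let s : C →ₗ[R] B := s0 - i ∘ₗ r ∘ₗ s0
  have hpi : ∀ x, p (i x) = 0 := h.apply_apply_eq_zero
  have hri : ∀ x, r (i x) = x := fun x => LinearMap.congr_fun hr x
  have hps0 : ∀ x, p (s0 x) = x := fun x => LinearMap.congr_fun hs0 x
  have hps : p ∘ₗ s = LinearMap.id := by
    ext x; simp [s, hpi, hps0]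
  have hid : i ∘ₗ r + s ∘ₗ p = LinearMap.id := by
    ext x
    obtain ⟨y, hy⟩ := (h (x - s0 (p x))).1 (by simp [hps0])
    have hx : x = i y + s0 (p x) := by rw [hy]; abel
    have : r x = y + r (s0 (p x)) := by
      conv_lhs => rw [hx]
      rw [map_add, hri]
    simp only [s, LinearMap.add_apply, LinearMap.comp_apply, LinearMap.sub_apply, LinearMap.id_apply]
    rw [this, map_add]
    nth_rewrite 4 [hx]
    abel
  have e : b = (b ∘ₗ i) ∘ₗ r + (b ∘ₗ s) ∘ₗ p := by
    rw [LinearMap.comp_assoc, LinearMap.comp_assoc, ← LinearMap.comp_add, hid, LinearMap.comp_id]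
  conv_lhs => rw [e]
  have e1 : LinearMap.trace R B ((b ∘ₗ i) ∘ₗ r) = LinearMap.trace R A a := by
    rw [hab, LinearMap.comp_assoc, LinearMap.trace_comp_comm', LinearMap.comp_assoc, hr,
      LinearMap.comp_id]
  have e2 : LinearMap.trace R B ((b ∘ₗ s) ∘ₗ p) = LinearMap.trace R C c := by
    rw [LinearMap.trace_comp_comm', ← LinearMap.comp_assoc, hbc, LinearMap.comp_assoc, hps,
      LinearMap.comp_id]
  rw [map_add, e1, e2]

section loc
variable {Λ : Type u} [Ring Λ] {R : Type u} [CommRing R] [IsLocalRing R]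
  (π : Λ →+* R) [RingHomSurjective π]

/-- The residue field as a right module. -/
noncomputable abbrev TR : ModuleCat.{u} Λᵐᵒᵖ := ModuleCat.of Λᵐᵒᵖ (Rt π (IsLocalRing.ResidueField R))

/-- The sequence `0 → m → R → k → 0` of right modules. -/
noncomputable abbrev mSC : ShortComplex (ModuleCat.{u} Λᵐᵒᵖ) where
  X₁ := ModuleCat.of Λᵐᵒᵖ (Rt π (IsLocalRing.maximalIdeal R))
  X₂ := ModuleCat.of Λᵐᵒᵖ (Rt π R)
  X₃ := TR π
  f := ModuleCat.ofHom (Rt.map π (IsLocalRing.maximalIdeal R).subtype)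
  g := ModuleCat.ofHom (Rt.map π (IsLocalRing.maximalIdeal R).mkQ)
  zero := by
    ext x
    exact (Submodule.Quotient.mk_eq_zero _).2 (Subtype.property (x : IsLocalRing.maximalIdeal R))

theorem mSC_shortExact : (mSC π).ShortExact where
  exact := by
    rw [ShortComplex.ShortExact.moduleCat_exact_iff_function_exact]
    exact LinearMap.exact_subtype_mkQ (IsLocalRing.maximalIdeal R)
  mono_f := (ModuleCat.mono_iff_injective _).2
    (Submodule.subtype_injective (IsLocalRing.maximalIdeal R))
  epi_g := (ModuleCat.epi_iff_surjective _).2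
    (Submodule.mkQ_surjective (IsLocalRing.maximalIdeal R))

variable {M : Type u} [AddCommGroup M] [Module Λ M] 
variable {π}

theorem TD.extend (hM : TD (TR π) 0 M) (f : Rt π (IsLocalRing.maximalIdeal R) →ₗ[Λᵐᵒᵖ] Dual M) :
    ∃ g : Rt π R →ₗ[Λᵐᵒᵖ] Dual M, g ∘ₗ Rt.map π (IsLocalRing.maximalIdeal R).subtype = f := by
  have := hM 1 (by omega)
  obtain ⟨y, hy⟩ := Ext.contravariant_sequence_exact₁ (mSC_shortExact π)
    (ModuleCat.of Λᵐᵒᵖ (Dual M)) (Ext.mk₀ (ModuleCat.ofHom f)) (add_zero 1) (Subsingleton.elim _ _)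
  obtain ⟨g, rfl⟩ := Ext.homEquiv₀.symm.surjective y
  refine ⟨g.hom, ?_⟩
  rw [Ext.homEquiv₀_symm_apply, Ext.mk₀_comp_mk₀] at hy
  have := Ext.homEquiv₀.symm.injective hy
  exact congrArg ModuleCat.Hom.hom this

theorem TD.red_free [IsNoetherianRing R] [Module.Finite Λ M] (hM : TD (TR π) 0 M) :
    Module.Free R (Red π M) := by
  have : Module.FinitePresentation R (Red π M) := Module.finitePresentation_of_finite R _
  apply Module.free_of_maximalIdeal_rTensor_injective
  refine injective_of_char
    ((IsLocalRing.maximalIdeal R).subtype.rTensor (Red π M)).toAddMonoidHom fun χ => ?_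
  obtain ⟨g, hg⟩ := hM.extend (homOfChar π χ)
  refine ⟨charOfHom π g, fun x => ?_⟩
  induction x using TensorProduct.induction_on with
  | zero => simp
  | add x y hx hy => rw [map_add, map_add, map_add, hx, hy]
  | tmul x y =>
    obtain ⟨m, rfl⟩ := Red.mk_surjective π M y
    rw [← homOfChar_apply, ← hg]
    rfl

variable {A B C : Type u} [AddCommGroup A] [Module Λ A] [AddCommGroup B] [Module Λ B]
  [AddCommGroup C] [Module Λ C] {i : A →ₗ[Λ] B} {p : B →ₗ[Λ] C}

theorem TD.red_split [IsNoetherianRing R] [Module.Finite Λ A] [Module.Finite Λ B]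
    (h : Function.Exact i p)
    (hi : Function.Injective i) (hp : Function.Surjective p)
    (hB : TD (TR π) 0 B) (hC : TD (TR π) 0 C) :
    ∃ r : Red π B →ₗ[R] Red π A, r ∘ₗ Red.map π i = LinearMap.id := by
  have := hB.red_free
  rw [IsLocalRing.split_injective_iff_lTensor_residueField_injective]
  refine injective_of_char
    ((Red.map π i).lTensor (IsLocalRing.ResidueField R)).toAddMonoidHom fun χ => ?_
  obtain ⟨g, hg⟩ := TD.lift h hi hp hC (ModuleCat.ofHom (homOfChar π χ))
  have hg : Dual.map i ∘ₗ g.hom = homOfChar π χ := congrArg ModuleCat.Hom.hom hg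
  refine ⟨charOfHom π g.hom, fun x => ?_⟩
  induction x using TensorProduct.induction_on with
  | zero => simp
  | add x y hx hy => rw [map_add, map_add, map_add, hx, hy]
  | tmul x y =>
    obtain ⟨m, rfl⟩ := Red.mk_surjective π A y
    rw [← homOfChar_apply, ← hg]
    rfl

variable (π) in
/-- The trace of an endomorphism on the reduction -/
noncomputable def tr (φ : M →ₗ[Λ] M) : R := LinearMap.trace R (Red π M) (Red.map π φ)

theorem TD.tr_add [IsNoetherianRing R] [Module.Finite Λ A] [Module.Finite Λ B]
    (h : Function.Exact i p)
    (hi : Function.Injective i) (hp : Function.Surjective p)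
    (hA : TD (TR π) 0 A) (hB : TD (TR π) 0 B) (hC : TD (TR π) 0 C)
    (a : A →ₗ[Λ] A) (b : B →ₗ[Λ] B) (c : C →ₗ[Λ] C) (hab : b ∘ₗ i = i ∘ₗ a)
    (hbc : p ∘ₗ b = c ∘ₗ p) : tr π b = tr π a + tr π c := by
  have := Module.Finite.of_surjective p hp
  have := hA.red_free
  have := hB.red_free
  have := hC.red_free
  obtain ⟨r, hr⟩ := TD.red_split h hi hp hB hC
  refine trace_add (Red.map π i) (Red.map π p) (Red.map_exact π i p h hp)
    (Red.map_surjective π p hp) r hr _ _ _ ?_ ?_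
  · rw [← Red.map_comp, hab, Red.map_comp]
  · rw [← Red.map_comp, hbc, Red.map_comp]

end loc
end SNL


namespace SNL
set_option linter.unusedSectionVars false
open CategoryTheory Abelian

section tri
variable {Λ : Type u} [Ring Λ]

/-- Modules with a filtration strictly lowered by an endomorphism, with graded pieces of bounded
dimension. -/
inductive Tri (T : ModuleCat.{u} Λᵐᵒᵖ) (d : ℕ) :
    ∀ (M : Type u) [AddCommGroup M] [Module Λ M], (M →ₗ[Λ] M) → Prop
  | zero (M : Type u) [AddCommGroup M] [Module Λ M] (φ : M →ₗ[Λ] M) (h : Subsingleton M) :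
      Tri T d M φ
  | step (M A C : Type u) [AddCommGroup M] [Module Λ M] [AddCommGroup A] [Module Λ A]
      [AddCommGroup C] [Module Λ C] (i : A →ₗ[Λ] M) (p : M →ₗ[Λ] C)
      (hi : Function.Injective i) (hp : Function.Surjective p) (hex : Function.Exact i p)
      (hC : Module.Finite Λ C) (hTD : TD T d C) (σ : M →ₗ[Λ] A)
      (hA : Tri T d A (σ ∘ₗ i)) : Tri T d M (i ∘ₗ σ)

variable {T : ModuleCat.{u} Λᵐᵒᵖ}

theorem Tri.finite {d : ℕ} {M : Type u} [AddCommGroup M] [Module Λ M] {φ : M →ₗ[Λ] M}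
    (h : Tri T d M φ) : Module.Finite Λ M := by
  induction h with
  | zero M φ h => infer_instance
  | step M A C i p hi hp hex hC hTD σ hA ih =>
    refine ⟨Submodule.fg_of_fg_map_of_fg_inf_ker p ?_ ?_⟩
    · rw [Submodule.map_top, LinearMap.range_eq_top.2 hp]
      exact hC.fg_top
    · rw [top_inf_eq, hex.linearMap_ker_eq, LinearMap.range_eq_map]
      exact Submodule.FG.map _ ih.fg_top

theorem Tri.of_nilpotent [IsNoetherianRing Λ] {d : ℕ}
    (hT : ∀ (M : Type u) [AddCommGroup M] [Module Λ M], TD T d M) (m : ℕ) :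
    ∀ (M : Type u) [AddCommGroup M] [Module Λ M] [Module.Finite Λ M] (φ : M →ₗ[Λ] M),
      φ ^ m = 0 → Tri T d M φ := by
  induction m with
  | zero =>
    intro M _ _ _ φ h
    refine Tri.zero M φ ⟨fun x y => ?_⟩
    have h1 : ∀ x : M, x = 0 := fun x => LinearMap.congr_fun h x
    rw [h1 x, h1 y]
  | succ m ih =>
    intro M _ _ _ φ h
    refine Tri.step M (LinearMap.range φ) (M ⧸ LinearMap.range φ) (LinearMap.range φ).subtype
      (LinearMap.range φ).mkQ (Submodule.subtype_injective _) (Submodule.mkQ_surjective _)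
      (LinearMap.exact_subtype_mkQ _) inferInstance (hT _) φ.rangeRestrict ?_
    apply ih
    have key : ∀ (n : ℕ) (x : LinearMap.range φ),
        (((φ.rangeRestrict ∘ₗ (LinearMap.range φ).subtype) ^ n) x : M) = (φ ^ n) (x : M) := by
      intro n
      induction n with
      | zero => intro x; rfl
      | succ n ih =>
        intro x
        rw [pow_succ', pow_succ', Module.End.mul_apply, Module.End.mul_apply, ← ih]
        rfl
    ext x
    rw [key]
    obtain ⟨_, y, rfl⟩ := x
    have := LinearMap.congr_fun h y
    rwa [pow_succ, Module.End.mul_apply] at this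

theorem exists_lift {K P N X : Type u} [AddCommGroup K] [Module Λ K] [AddCommGroup P] [Module Λ P]
    [AddCommGroup N] [Module Λ N] [AddCommGroup X] [Module Λ X]
    (j : K →ₗ[Λ] P) (g : P →ₗ[Λ] N) (hj : Function.Injective j) (h : Function.Exact j g)
    (f : X →ₗ[Λ] P) (hf : ∀ x, g (f x) = 0) : ∃ f' : X →ₗ[Λ] K, ∀ x, j (f' x) = f x := by
  refine ⟨(LinearEquiv.ofInjective j hj).symm.toLinearMap ∘ₗ
    f.codRestrict (LinearMap.range j) (fun x => (h _).1 (hf x)), fun x => ?_⟩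
  have := (LinearEquiv.ofInjective j hj).apply_symm_apply
    (f.codRestrict (LinearMap.range j) (fun x => (h _).1 (hf x)) x)
  exact congrArg Subtype.val this

theorem Tri.syz [IsNoetherianRing Λ] {d : ℕ} {M : Type u} [AddCommGroup M] [Module Λ M]
    {φ : M →ₗ[Λ] M} (h : Tri T (d + 1) M φ) :
    ∃ (P K : Type u) (_ : AddCommGroup P) (_ : Module Λ P) (_ : AddCommGroup K) (_ : Module Λ K)
      (j : K →ₗ[Λ] P) (g : P →ₗ[Λ] M) (ψ : P →ₗ[Λ] P) (κ : K →ₗ[Λ] K),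
      Function.Injective j ∧ Function.Surjective g ∧ Function.Exact j g ∧
      g ∘ₗ ψ = φ ∘ₗ g ∧ ψ ∘ₗ j = j ∘ₗ κ ∧ Tri T 0 P ψ ∧ Tri T d K κ := by
  induction h with
  | zero M φ h =>
    refine ⟨PUnit, PUnit, inferInstance, inferInstance, inferInstance, inferInstance, 0, 0, 0, 0,
      fun _ _ _ => rfl, fun x => ⟨0, Subsingleton.elim _ _⟩, fun x => ⟨fun _ => ⟨0, rfl⟩,
      fun _ => rfl⟩, ?_, ?_, Tri.zero _ _ inferInstance, Tri.zero _ _ inferInstance⟩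
    · refine LinearMap.ext fun x => Subsingleton.elim _ _
    · refine LinearMap.ext fun x => rfl
  | step M A C i p hi hp hex hC hTD σ hA ih =>
    obtain ⟨P, K, _, _, _, _, j, g, ψ, κ, hj, hg, hjg, hgψ, hψj, hP, hK⟩ := ih
    obtain ⟨n, c, hc⟩ := Module.Finite.exists_fin' Λ C
    obtain ⟨h, hh⟩ := Module.projective_lifting_property p c hp
    obtain ⟨l, hl⟩ := Module.projective_lifting_property g (σ ∘ₗ h) hg
    have hh' : ∀ q, p (h q) = c q := fun q => LinearMap.congr_fun hh q
    have hl' : ∀ q, g (l q) = σ (h q) := fun q => LinearMap.congr_fun hl q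
    have hgψ' : ∀ q, g (ψ q) = σ (i (g q)) := fun q => LinearMap.congr_fun hgψ q
    have hpi : ∀ x, p (i x) = 0 := hex.apply_apply_eq_zero
    have hgj : ∀ x, g (j x) = 0 := hjg.apply_apply_eq_zero
    let G : P × (Fin n → Λ) →ₗ[Λ] M := LinearMap.coprod (i ∘ₗ g) h
    have hG : ∀ x, G x = i (g x.1) + h x.2 := fun x => rfl
    let S : P × (Fin n → Λ) →ₗ[Λ] P := LinearMap.coprod ψ l
    have hS : ∀ x, S x = ψ x.1 + l x.2 := fun x => rfl
    have hgS : ∀ x, g (S x) = σ (G x) := fun x => by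
      rw [hS, hG, map_add, map_add, hl', hgψ']
    -- the kernel filtration
    let i' : K →ₗ[Λ] LinearMap.ker G := (LinearMap.inl Λ P (Fin n → Λ) ∘ₗ j).codRestrict _
      (fun x => by
        rw [LinearMap.mem_ker, hG]
        simp [hgj])
    have hi' : ∀ x, (i' x : P × (Fin n → Λ)) = (j x, 0) := fun x => rfl
    let p' : LinearMap.ker G →ₗ[Λ] LinearMap.ker c :=
      ((LinearMap.snd Λ P (Fin n → Λ)) ∘ₗ (LinearMap.ker G).subtype).codRestrict _ (fun x => by
        have hx : i (g x.1.1) + h x.1.2 = 0 := x.2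
        have := congrArg p hx
        rw [map_add, hpi, zero_add, hh', map_zero] at this
        exact this)
    have hp' : ∀ x, (p' x : Fin n → Λ) = x.1.2 := fun x => rfl
    obtain ⟨s', hs'⟩ := exists_lift j g hj hjg (S ∘ₗ (LinearMap.ker G).subtype) (fun x => by
      have hx : G x.1 = 0 := x.2
      change g (S x.1) = 0
      rw [hgS, hx, map_zero])
    refine ⟨P × (Fin n → Λ), LinearMap.ker G, inferInstance, inferInstance, inferInstance,
      inferInstance, (LinearMap.ker G).subtype, G, LinearMap.inl Λ P (Fin n → Λ) ∘ₗ S,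
      i' ∘ₗ s', Submodule.subtype_injective _, ?_, LinearMap.exact_subtype_ker_map G, ?_, ?_, ?_, ?_⟩
    · intro m
      obtain ⟨q, hq⟩ := hc (p m)
      obtain ⟨a, ha⟩ := (hex (m - h q)).1 (by rw [map_sub, hh', hq, sub_self])
      obtain ⟨x, rfl⟩ := hg a
      refine ⟨(x, q), ?_⟩
      rw [hG, ha]
      simp
    · refine LinearMap.ext fun x => ?_
      change i (g (S x)) + h 0 = i (σ (G x))
      rw [hgS, map_zero, add_zero]
    · refine LinearMap.ext fun x => ?_
      change (S x.1, 0) = (i' (s' x)).1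
      rw [hi', hs']
      rfl
    · refine Tri.step _ P (Fin n → Λ) (LinearMap.inl Λ P (Fin n → Λ))
        (LinearMap.snd Λ P (Fin n → Λ)) LinearMap.inl_injective LinearMap.snd_surjective
        (fun x => ⟨fun hx => ⟨x.1, Prod.ext rfl hx.symm⟩, ?_⟩) inferInstance (TD.free _) S ?_
      · rintro ⟨y, rfl⟩; rfl
      · convert hP using 1
        refine LinearMap.ext fun x => ?_
        change ψ x + l 0 = ψ x
        rw [map_zero, add_zero]
    · refine Tri.step _ K (LinearMap.ker c) i' p' ?_ ?_ ?_ inferInstance ?_ s' ?_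
      · intro x y hxy
        have := congrArg (fun z => (z.1).1) hxy
        exact hj this
      · intro q
        obtain ⟨a, ha⟩ := (hex (h q.1)).1 (by rw [hh']; exact q.2)
        obtain ⟨x, hx⟩ := hg (-a)
        refine ⟨⟨(x, q.1), ?_⟩, ?_⟩
        · rw [LinearMap.mem_ker, hG, hx, map_neg, ha]
          simp
        · exact Subtype.ext rfl
      · intro x
        constructor
        · intro hx
          have h2 : x.1.2 = 0 := congrArg Subtype.val hx
          have h1 : i (g x.1.1) + h x.1.2 = 0 := x.2
          rw [h2, map_zero, add_zero] at h1
          obtain ⟨y, hy⟩ := (hjg x.1.1).1 (hi (by rw [h1, map_zero]))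
          exact ⟨y, Subtype.ext (Prod.ext hy h2.symm)⟩
        · rintro ⟨y, rfl⟩
          exact Subtype.ext rfl
      · exact TD.syz (LinearMap.exact_subtype_ker_map c) (Submodule.subtype_injective _) hc
          (TD.free _) hTD
      · convert hK using 1
        refine LinearMap.ext fun x => hj ?_
        rw [LinearMap.comp_apply, hs']
        have := LinearMap.congr_fun hψj x
        change ψ (j x) + l 0 = j (κ x)
        rw [map_zero, add_zero]
        exact this

variable {R : Type u} [CommRing R] [IsLocalRing R] [IsNoetherianRing R]
  {π : Λ →+* R} [RingHomSurjective π]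

theorem Tri.base {M : Type u} [AddCommGroup M] [Module Λ M]
    {φ : M →ₗ[Λ] M} (h : Tri (TR π) 0 M φ) : TD (TR π) 0 M ∧ tr π φ = 0 := by
  induction h with
  | zero M φ h =>
    refine ⟨TD.of_subsingleton 0, ?_⟩
    have : φ = 0 := LinearMap.ext fun x => Subsingleton.elim _ _
    rw [this, tr, Red.map_zero, map_zero]
  | step M A C i p hi hp hex hC hTD σ hA ih =>
    have h1 := TD.mid hex hi hp ih.1 hTD
    refine ⟨h1, ?_⟩
    have := hA.finite
    have := (Tri.step M A C i p hi hp hex hC hTD σ hA).finite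
    rw [TD.tr_add hex hi hp ih.1 h1 hTD (σ ∘ₗ i) (i ∘ₗ σ) 0 rfl, ih.2, tr, Red.map_zero,
      map_zero, add_zero]
    refine LinearMap.ext fun x => ?_
    exact hex.apply_apply_eq_zero _

theorem Tri.main [IsNoetherianRing Λ] (d : ℕ) : ∀ {M : Type u} [AddCommGroup M] [Module Λ M]
    {φ : M →ₗ[Λ] M} (_ : Tri (TR π) d M φ) (_ : TD (TR π) 0 M), tr π φ = 0 := by
  induction d with
  | zero => intro M _ _ φ h _; exact h.base.2
  | succ d ih =>
    intro M _ _ φ h hM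
    obtain ⟨P, K, _, _, _, _, j, g, ψ, κ, hj, hg, hjg, hgψ, hψj, hP, hK⟩ := h.syz
    have := hP.finite
    have := hK.finite
    have hK0 := TD.syz hjg hj hg hP.base.1 (hM.mono (Nat.zero_le 1))
    have := TD.tr_add hjg hj hg hK0 hP.base.1 hM κ ψ φ hψj hgψ
    rw [hP.base.2, ih hK hK0, zero_add] at this
    exact this.symm

/-- Right multiplication on the free module of rank one. -/
def rmul (a : Λ) : (Fin 1 → Λ) →ₗ[Λ] (Fin 1 → Λ) where
  toFun v := fun _ => v 0 * a
  map_add' v w := by ext; simp [add_mul]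
  map_smul' c v := by ext; simp [mul_assoc]

theorem rmul_pow (a : Λ) (n : ℕ) (v : Fin 1 → Λ) : (rmul a ^ n) v = fun _ => v 0 * a ^ n := by
  induction n with
  | zero => ext i; fin_cases i; simp
  | succ n ih =>
    rw [pow_succ', Module.End.mul_apply, ih]
    ext
    simp [rmul, mul_assoc, pow_succ]

theorem tr_rmul (a : Λ) : tr π (rmul a) = π a := by
  let e0 : Red π (Fin 1 → Λ) →+ R := Red.liftAdd π
    (π.toAddMonoidHom.comp (Pi.evalAddMonoidHom (fun _ : Fin 1 => Λ) 0)) (by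
      intro c m hc
      change π (c * m 0) = 0
      rw [map_mul, hc, zero_mul])
  have he0 : ∀ v, e0 (Red.mk π _ v) = π (v 0) := fun v => rfl
  let e1 : Red π (Fin 1 → Λ) →ₗ[R] R :=
    { e0 with
      map_smul' := fun r x => by
        obtain ⟨c, rfl⟩ := RingHomSurjective.is_surjective (σ := π) r
        obtain ⟨v, rfl⟩ := Red.mk_surjective π _ x
        change e0 (π c • Red.mk π _ v) = π c • e0 (Red.mk π _ v)
        rw [Red.map_smul', ← map_smul, he0, he0]
        exact map_mul π _ _ }
  have he1 : ∀ v, e1 (Red.mk π _ v) = π (v 0) := fun v => rfl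
  have hinj : Function.Injective e1 := by
    rw [injective_iff_map_eq_zero]
    intro x hx
    obtain ⟨v, rfl⟩ := Red.mk_surjective π _ x
    rw [he1] at hx
    have : v = v 0 • (fun _ => 1) := by ext i; fin_cases i; simp
    rw [this, map_smul]
    exact Red.smul_eq_zero π hx _
  have hsurj : Function.Surjective e1 := fun r => by
    obtain ⟨c, rfl⟩ := RingHomSurjective.is_surjective (σ := π) r
    exact ⟨Red.mk π _ (fun _ => c), rfl⟩
  let e := LinearEquiv.ofBijective e1 ⟨hinj, hsurj⟩
  have hsmul : Red.map π (rmul a) = π a • LinearMap.id := by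
    refine LinearMap.ext fun x => hinj ?_
    obtain ⟨v, rfl⟩ := Red.mk_surjective π _ x
    rw [Red.map_mk, he1, LinearMap.smul_apply, map_smul, LinearMap.id_apply, he1]
    change π (v 0 * a) = π a * π (v 0)
    rw [map_mul, mul_comm]
  have : Module.Free R (Red π (Fin 1 → Λ)) := Module.Free.of_equiv e.symm
  rw [tr, hsmul, map_smul, LinearMap.trace_id, e.finrank_eq]
  simp

/-- The key theorem: nilpotent elements map to zero. -/
theorem map_nilpotent_eq_zero [IsNoetherianRing Λ] (d : ℕ)
    (hT : ∀ (M : Type u) [AddCommGroup M] [Module Λ M], TD (TR π) d M) (a : Λ)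
    (ha : IsNilpotent a) : π a = 0 := by
  obtain ⟨n, hn⟩ := ha
  have h1 : Tri (TR π) d _ (rmul a) := Tri.of_nilpotent hT n _ _ (by
    refine LinearMap.ext fun v => ?_
    rw [rmul_pow, hn]
    ext; simp)
  rw [← tr_rmul (π := π) a]
  exact Tri.main d h1 (TD.free _)

end tri
end SNL


namespace SNL
set_option linter.unusedSectionVars false
open CategoryTheory Abelian

section ring
variable {Λ : Type u} [Ring Λ]

theorem unit_swap {a b : Λ} (h : IsUnit (1 - a * b)) : IsUnit (1 - b * a) := by
  obtain ⟨c, hc⟩ := h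
  have h1 : (1 - a * b) * (↑c⁻¹ : Λ) = 1 := by rw [← hc]; simp
  have h2 : (↑c⁻¹ : Λ) * (1 - a * b) = 1 := by rw [← hc]; simp
  refine ⟨⟨1 - b * a, 1 + b * ↑c⁻¹ * a, ?_, ?_⟩, rfl⟩
  · have : (1 - b * a) * (1 + b * ↑c⁻¹ * a) = 1 - b * a + b * ((1 - a * b) * ↑c⁻¹) * a := by
      noncomm_ring
    rw [this, h1]; noncomm_ring
  · have : (1 + b * ↑c⁻¹ * a) * (1 - b * a) = 1 - b * a + b * (↑c⁻¹ * (1 - a * b)) * a := by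
      noncomm_ring
    rw [this, h2]; noncomm_ring

theorem J_left {x : Λ} (hx : x ∈ Jset Λ) (z : Λ) : z * x ∈ Jset Λ := fun y => by
  rw [← mul_assoc]; exact hx _

theorem J_right {x : Λ} (hx : x ∈ Jset Λ) (z : Λ) : x * z ∈ Jset Λ := fun y => by
  have := unit_swap (hx (z * y))
  rw [← mul_assoc] at this
  have := unit_swap this
  rw [← mul_assoc] at this
  have h := unit_swap (a := z) (b := y * x) (by rw [← mul_assoc]; exact hx (z * y))
  rwa [mul_assoc] at h

theorem J_add {x z : Λ} (hx : x ∈ Jset Λ) (hz : z ∈ Jset Λ) : x + z ∈ Jset Λ := fun y => by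
  obtain ⟨c, hc⟩ := hx y
  have : 1 - y * (x + z) = c * (1 - (↑c⁻¹ * y) * z) := by
    rw [mul_sub, mul_one, ← mul_assoc, ← mul_assoc, Units.mul_inv, one_mul, hc]
    noncomm_ring
  rw [this]
  exact c.isUnit.mul (hz _)

theorem J_neg {x : Λ} (hx : x ∈ Jset Λ) : -x ∈ Jset Λ := by
  have := J_left hx (-1)
  rwa [neg_one_mul] at this

theorem J_zero : (0 : Λ) ∈ Jset Λ := fun y => by simp

theorem J_of_right {x : Λ} (h : ∀ y, IsUnit (1 - x * y)) : x ∈ Jset Λ := fun y => unit_swap (h y)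

theorem Jsq_le {x : Λ} (hx : x ∈ Jsq Λ) : x ∈ Jset Λ := by
  induction hx using AddSubgroup.closure_induction with
  | mem x h => obtain ⟨a, ha, b, hb, rfl⟩ := h; exact J_left hb a
  | zero => exact J_zero
  | add x y _ _ hx hy => exact J_add hx hy
  | neg x _ hx => exact J_neg hx


theorem J_nilpotent
    (k : Type u) [CommRing k] [IsArtinianRing k] [Algebra k Λ] [Module.Finite k Λ]
    {a : Λ} (ha : a ∈ Jset Λ) : IsNilpotent a := by
  obtain ⟨n, hn, hn1⟩ := ((LinearMap.eventually_isCompl_ker_pow_range_pow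
    (LinearMap.mulRight k a)).and (Filter.eventually_ge_atTop 1)).exists
  rw [LinearMap.pow_mulRight] at hn
  obtain ⟨u, hu, v, hv, huv⟩ := Submodule.mem_sup.1
    (hn.codisjoint.eq_top ▸ Submodule.mem_top : (1 : Λ) ∈ _)
  obtain ⟨w, rfl⟩ := hv
  rw [LinearMap.mem_ker, LinearMap.mulRight_apply] at hu
  rw [LinearMap.mulRight_apply] at huv
  refine ⟨n, ?_⟩
  obtain ⟨m, rfl⟩ : ∃ m, n = m + 1 := ⟨n - 1, by omega⟩
  have h1 := ha (w * a ^ m)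
  rw [mul_assoc, ← pow_succ] at h1
  have h2 : (1 - w * a ^ (m + 1)) = u := by rw [← huv]; abel
  rw [h2] at h1
  exact (h1.mul_right_eq_zero).1 hu

theorem fitting
    (k : Type u) [CommRing k] [IsArtinianRing k] [Algebra k Λ] [Module.Finite k Λ]
    {e : Λ} (he : IsPrimitiveIdem e) {x : Λ} (h1 : e * x = x) (h2 : x * e = x) :
    IsNilpotent x ∨ ∃ w, e * w = w ∧ w * e = w ∧ x * w = e := by
  obtain ⟨hne, hidem, hprim⟩ := he
  have hee : e * e = e := hidem
  obtain ⟨n, hn, hn1⟩ := ((LinearMap.eventually_isCompl_ker_pow_range_pow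
    (LinearMap.mulLeft k x)).and (Filter.eventually_ge_atTop 1)).exists
  rw [LinearMap.pow_mulLeft] at hn
  obtain ⟨u, hu, v, hv, huv⟩ := Submodule.mem_sup.1
    (hn.codisjoint.eq_top ▸ Submodule.mem_top : e ∈ _)
  obtain ⟨m, rfl⟩ : ∃ m, n = m + 1 := ⟨n - 1, by omega⟩
  have hd := Submodule.disjoint_def.1 hn.disjoint
  have hK : ∀ y, y ∈ (LinearMap.mulLeft k (x ^ (m + 1))).ker ↔ x ^ (m + 1) * y = 0 := fun y => by
    rw [LinearMap.mem_ker, LinearMap.mulLeft_apply]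
  have hI : ∀ y, y ∈ (LinearMap.mulLeft k (x ^ (m + 1))).range ↔ ∃ w, x ^ (m + 1) * w = y :=
    fun y => by simp [LinearMap.mem_range]
  generalize hxn : x ^ (m + 1) = X at hd hK hI hu hv
  have hXe : X * e = X := by rw [← hxn, pow_succ, mul_assoc, h2]
  have heX : e * X = X := by rw [← hxn, pow_succ', ← mul_assoc, h1]
  -- uniqueness of decompositions
  have huniq : ∀ a b, X * a = 0 → (∃ w, X * w = b) → a + b = 0 → a = 0 ∧ b = 0 := by
    intro a b ha hb hab
    have hba : b = -a := by rw [← add_eq_zero_iff_eq_neg, add_comm]; exact hab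
    have hb0 : b = 0 := hd b ((hK b).2 (by rw [hba, mul_neg, ha, neg_zero])) ((hI b).2 hb)
    refine ⟨?_, hb0⟩
    rw [hb0, add_zero] at hab
    exact hab
  rw [hK] at hu
  rw [hI] at hv
  obtain ⟨w, rfl⟩ := hv
  have eu : e * u = u := by
    have := huniq (e * u - u) (e * (X * w) - X * w)
      (by rw [mul_sub, ← mul_assoc, hXe, hu, sub_zero])
      ⟨0, by rw [← mul_assoc, heX]; simp⟩
      (by
        have : e * u - u + (e * (X * w) - X * w) = e * (u + X * w) - (u + X * w) := by
          noncomm_ring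
        rw [this, huv, hee, sub_self])
    exact sub_eq_zero.1 this.1
  have ue := huniq (u * e - u) (X * w * e - X * w)
      (by rw [mul_sub, ← mul_assoc, hu, zero_mul, sub_zero])
      ⟨w * e - w, by noncomm_ring⟩
      (by
        have : u * e - u + (X * w * e - X * w) = (u + X * w) * e - (u + X * w) := by
          noncomm_ring
        rw [this, huv, hee, sub_self])
  have uu := huniq (u * u - u) (X * w * u)
      (by rw [mul_sub, ← mul_assoc, hu, zero_mul, sub_zero])
      ⟨w * u, by noncomm_ring⟩
      (by
        have : u * u - u + X * w * u = (u + X * w) * u - u := by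
          noncomm_ring
        rw [this, huv, eu, sub_self])
  have vv := huniq (u * (X * w)) (X * w * (X * w) - X * w)
      (by rw [← mul_assoc, hu, zero_mul])
      ⟨w * (X * w) - w, by noncomm_ring⟩
      (by
        have : u * (X * w) + (X * w * (X * w) - X * w) = (u + X * w) * (X * w) - X * w := by
          noncomm_ring
        rw [this, huv, ← mul_assoc, heX, sub_self])
  rcases hprim u (X * w) (sub_eq_zero.1 uu.1) (sub_eq_zero.1 vv.2) vv.1 uu.2 huv with h | h
  · right
    rw [h, zero_add] at huv
    refine ⟨e * (x ^ m * w) * e, ?_, ?_, ?_⟩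
    · rw [← mul_assoc, ← mul_assoc, hee]
    · rw [mul_assoc _ e e, hee]
    · rw [← mul_assoc, ← mul_assoc, h2, ← mul_assoc, ← pow_succ', hxn, huv, hee]
  · left
    rw [h, add_zero] at huv
    rw [huv, hXe] at hu
    exact ⟨m + 1, by rw [hxn, hu]⟩

theorem eJ1
    (k : Type u) [CommRing k] [IsArtinianRing k] [Algebra k Λ] [Module.Finite k Λ]
    {e : Λ} (he : IsBasicIdem e) (l : Λ) : e * l * (1 - e) ∈ Jset Λ := by
  obtain ⟨hp, hb⟩ := he
  have hee : e * e = e := hp.2.1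
  refine J_of_right fun y => ?_
  have h0 : e * l * (1 - e) * y = e * (e * l * (1 - e) * y) := by
    simp only [← mul_assoc]; rw [hee]
  rw [h0]
  apply unit_swap
  rcases fitting k hp (x := e * l * (1 - e) * y * e) (by simp only [← mul_assoc]; rw [hee])
    (by rw [mul_assoc _ e e, hee]) with h | ⟨w, hw1, hw2, hw3⟩
  · exact h.isUnit_one_sub
  · refine absurd ⟨e * l * (1 - e), (1 - e) * y * e * w, ?_, ?_, ?_⟩ hb
    · have : e * (e * l * (1 - e)) * (1 - e) = (e * e) * l * (1 - 2 * e + e * e) := by noncomm_ring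
      rw [this, hee]; noncomm_ring
    · have : (1 - e) * ((1 - e) * y * e * w) * e = (1 - 2 * e + e * e) * y * e * (w * e) := by
        noncomm_ring
      rw [this, hee, hw2]; noncomm_ring
    · have : e * l * (1 - e) * ((1 - e) * y * e * w) = e * l * (1 - 2 * e + e * e) * y * e * w := by
        noncomm_ring
      rw [this, hee]
      refine Eq.trans ?_ hw3
      noncomm_ring

theorem eJ2
    (k : Type u) [CommRing k] [IsArtinianRing k] [Algebra k Λ] [Module.Finite k Λ]
    {e : Λ} (he : IsBasicIdem e) (l : Λ) : (1 - e) * l * e ∈ Jset Λ := by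
  obtain ⟨hp, hb⟩ := he
  have hee : e * e = e := hp.2.1
  intro y
  rw [← mul_assoc]
  apply unit_swap
  rcases fitting k hp (x := e * (y * ((1 - e) * l)) * e) (by simp only [← mul_assoc]; rw [hee])
    (by rw [mul_assoc _ e e, hee]) with h | ⟨w, hw1, hw2, hw3⟩
  · have h := h.isUnit_one_sub
    have := unit_swap (a := e * (y * ((1 - e) * l))) h
    have := unit_swap this
    have h3 := unit_swap (a := e * (y * ((1 - e) * l))) h
    rw [← mul_assoc, hee] at h3
    exact h3
  · refine absurd ⟨e * y * (1 - e), (1 - e) * l * e * w, ?_, ?_, ?_⟩ hb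
    · have : e * (e * y * (1 - e)) * (1 - e) = (e * e) * y * (1 - 2 * e + e * e) := by noncomm_ring
      rw [this, hee]; noncomm_ring
    · have : (1 - e) * ((1 - e) * l * e * w) * e = (1 - 2 * e + e * e) * l * e * (w * e) := by
        noncomm_ring
      rw [this, hee, hw2]; noncomm_ring
    · have : e * y * (1 - e) * ((1 - e) * l * e * w) = e * y * (1 - 2 * e + e * e) * l * e * w := by
        noncomm_ring
      rw [this, hee]
      refine Eq.trans ?_ hw3
      noncomm_ring

/-- The two-sided ideal defining the local quotient. -/
def eIdeal (e : Λ) : TwoSidedIdeal Λ := TwoSidedIdeal.mk'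
  {x | ∀ y z, e * y * x * z * e ∈ Jsq Λ}
  (fun y z => by simp [zero_mem])
  (fun {a b} ha hb y z => by
    have := add_mem (ha y z) (hb y z)
    rw [mul_add, add_mul, add_mul]; exact this)
  (fun {a} ha y z => by
    have := neg_mem (ha y z)
    rw [mul_neg, neg_mul, neg_mul]; exact this)
  (fun {a b} hb y z => by
    have := hb (y * a) z
    simp only [← mul_assoc] at this ⊢; exact this)
  (fun {a b} ha y z => by
    have := ha y (b * z)
    simp only [← mul_assoc] at this ⊢; exact this)

theorem exists_quot
    (k : Type u) [CommRing k] [IsArtinianRing k] [Algebra k Λ] [Module.Finite k Λ]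
    {e : Λ} (he : IsBasicIdem e) (hcomm : ∀ x y : Λ,
      (e * x * e) * (e * y * e) - (e * y * e) * (e * x * e) ∈ Jsq Λ) :
    ∃ (R : Type u) (_ : CommRing R) (_ : IsLocalRing R) (π : Λ →+* R),
      Function.Surjective π ∧ π e = 1 ∧ ∀ a, π a = 0 → e * a * e ∈ Jsq Λ := by
  have hee : e * e = e := he.1.2.1
  let π0 : Λ →+* (eIdeal e).ringCon.Quotient := (eIdeal e).ringCon.mk'
  have hs : Function.Surjective π0 := RingCon.mk'_surjective _
  have h0 : ∀ a, π0 a = 0 ↔ ∀ y z, e * y * a * z * e ∈ Jsq Λ := by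
    intro a
    have h1 : π0 a = 0 ↔ a ∈ eIdeal e := by
      rw [TwoSidedIdeal.mem_iff]
      exact RingCon.eq _
    rw [h1]
    exact TwoSidedIdeal.mem_mk' _ _ _ _ _ _ _
  have he1 : π0 e = 1 := by
    rw [eq_comm, ← sub_eq_zero, ← map_one π0, ← map_sub, h0]
    intro y z
    refine AddSubgroup.subset_closure ⟨_, eJ1 k he y, _, eJ2 k he z, ?_⟩
    have : e * y * (1 - e) * ((1 - e) * z * e) = e * y * (1 - 2 * e + e * e) * z * e := by
      noncomm_ring
    rw [this, hee]; noncomm_ring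
  have hJ : ∀ a ∈ Jsq Λ, π0 a = 0 := by
    intro a ha
    induction ha using AddSubgroup.closure_induction with
    | mem x h =>
      obtain ⟨a, ha, b, hb, rfl⟩ := h
      rw [h0]
      intro y z
      refine AddSubgroup.subset_closure ⟨_, J_left ha (e * y), _, J_right hb (z * e), ?_⟩
      noncomm_ring
    | zero => exact map_zero _
    | add x y _ _ hx hy => rw [map_add, hx, hy, add_zero]
    | neg x _ hx => rw [map_neg, hx, neg_zero]
  have hexe : ∀ x, π0 x = π0 (e * x * e) := fun x => by
    rw [map_mul, map_mul, he1, one_mul, mul_one]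
  let cr : CommRing (eIdeal e).ringCon.Quotient :=
    { (inferInstance : Ring (eIdeal e).ringCon.Quotient) with
      mul_comm := fun a b => by
        obtain ⟨x, rfl⟩ := hs a
        obtain ⟨y, rfl⟩ := hs b
        rw [← sub_eq_zero, hexe x, hexe y, ← map_mul, ← map_mul, ← map_sub]
        exact hJ _ (hcomm x y) }
  have hnt : Nontrivial (eIdeal e).ringCon.Quotient := by
    refine ⟨⟨0, 1, fun h => ?_⟩⟩
    have h1 := (h0 1).1 (by rw [map_one]; exact h.symm) 1 1
    simp only [mul_one, hee] at h1
    have h2 := Jsq_le h1 1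
    rw [one_mul] at h2
    apply he.1.1
    refine (h2.mul_left_eq_zero).1 ?_
    rw [mul_sub, mul_one, hee, sub_self]
  have hloc : IsLocalRing (eIdeal e).ringCon.Quotient := by
    refine IsLocalRing.of_isUnit_or_isUnit_one_sub_self fun a => ?_
    obtain ⟨x, rfl⟩ := hs a
    rw [hexe]
    rcases fitting k he.1 (x := e * x * e) (by simp only [← mul_assoc]; rw [hee])
      (by rw [mul_assoc _ e e, hee]) with h | ⟨w, hw1, hw2, hw3⟩
    · right
      exact (h.map π0).isUnit_one_sub
    · left
      refine IsUnit.of_mul_eq_one (π0 w) ?_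
      rw [← map_mul, hw3, he1]
  refine ⟨_, cr, hloc, π0, hs, he1, fun a ha => ?_⟩
  simpa using (h0 a).1 ha 1 1

end ring

section seMod
variable {Λ : Type u} [Ring Λ] {e : Λ}
variable {R : Type u} [CommRing R] [IsLocalRing R] (π : Λ →+* R)
  [RingHomSurjective π]

/-- The map from `eΛ` to the residue field. -/
noncomputable def eMap (e : Λ) : eSub Λ e →ₗ[Λᵐᵒᵖ] Rt π (IsLocalRing.ResidueField R) where
  toFun x := Rt.of π _ (IsLocalRing.residue R (π x.1))
  map_add' x y := by
    rw [← map_add, ← map_add, ← map_add]; rfl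
  map_smul' c x := by
    rw [RingHom.id_apply, Rt.op_smul, AddEquiv.symm_apply_apply, Algebra.smul_def]
    congr 1
    change IsLocalRing.residue R (π (x.1 * c.unop)) =
      IsLocalRing.residue R (π c.unop) * IsLocalRing.residue R (π x.1)
    rw [map_mul, map_mul, mul_comm]

theorem eMap_ker
    (k : Type u) [CommRing k] [IsArtinianRing k] [Algebra k Λ] [Module.Finite k Λ]
    (he : IsBasicIdem e) (hs : Function.Surjective π) (h1 : π e = 1) :
    LinearMap.ker (eMap π e) = Submodule.span Λᵐᵒᵖ {x : eSub Λ e | (x : Λ) ∈ Jset Λ} := by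
  have hee : e * e = e := he.1.2.1
  have key : ∀ x : eSub Λ e, eMap π e x = 0 ↔ (x : Λ) ∈ Jset Λ := by
    intro x
    have hx : e * (x : Λ) = x := x.2
    have h2 : eMap π e x = 0 ↔ ¬ IsUnit (π x) := by
      have : eMap π e x = 0 ↔ IsLocalRing.residue R (π x.1) = 0 := Iff.rfl
      rw [this, IsLocalRing.residue_eq_zero_iff, IsLocalRing.mem_maximalIdeal, mem_nonunits_iff]
    rw [h2]
    constructor
    · intro hu
      refine J_of_right fun y => ?_
      rcases fitting k he.1 (x := x.1 * y * e) (by simp only [← mul_assoc]; rw [hx])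
        (by rw [mul_assoc _ e e, hee]) with h | ⟨w, hw1, hw2, hw3⟩
      · have := unit_swap (a := x.1 * y) (b := e) h.isUnit_one_sub
        rwa [← mul_assoc, hx] at this
      · refine absurd (IsUnit.of_mul_eq_one (π (y * e * w)) ?_) hu
        rw [← map_mul, ← mul_assoc, ← mul_assoc, hw3, h1]
    · intro hJ hu
      obtain ⟨b, hb⟩ := hu.exists_right_inv
      obtain ⟨y, rfl⟩ := hs b
      have := (hJ y).map π
      rw [map_sub, map_mul, mul_comm, hb, map_one, sub_self] at this
      exact not_isUnit_zero this
  ext x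
  rw [LinearMap.mem_ker]
  constructor
  · intro h
    exact Submodule.subset_span ((key x).1 h)
  · intro h
    have : Submodule.span Λᵐᵒᵖ {x : eSub Λ e | (x : Λ) ∈ Jset Λ} ≤ LinearMap.ker (eMap π e) :=
      Submodule.span_le.2 fun y hy => (key y).2 hy
    exact this h

theorem eMap_equiv
    (k : Type u) [CommRing k] [IsArtinianRing k] [Algebra k Λ] [Module.Finite k Λ]
    (he : IsBasicIdem e) (hs : Function.Surjective π) (h1 : π e = 1) :
    Nonempty (SeMod Λ e ≃ₗ[Λᵐᵒᵖ] Rt π (IsLocalRing.ResidueField R)) := by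
  have hsurj : Function.Surjective (eMap π e) := by
    intro z
    obtain ⟨r, hr⟩ := IsLocalRing.residue_surjective (R := R) ((Rt.of π _).symm z)
    obtain ⟨x, rfl⟩ := hs r
    have hee : e * e = e := he.1.2.1
    refine ⟨⟨e * x, by change e * (e * x) = e * x; rw [← mul_assoc, hee]⟩, ?_⟩
    change Rt.of π _ (IsLocalRing.residue R (π (e * x))) = z
    rw [map_mul, h1, one_mul, hr, AddEquiv.apply_symm_apply]
  exact ⟨(Submodule.quotEquivOfEq _ _ (eMap_ker π k he hs h1).symm).trans
    (LinearMap.quotKerEquivOfSurjective _ hsurj)⟩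

end seMod

section pd
variable {Γ : Type u} [Ring Γ]

theorem pd_aux (N : ℕ) : ∀ (P : ℕ → ModuleCat.{u} Γ) (f : ∀ i, P (i+1) →ₗ[Γ] P i)
    (M : Type u) [AddCommGroup M] [Module Γ M] (g : P 0 →ₗ[Γ] M),
    (∀ i, Module.Projective Γ (P i)) → Function.Surjective g →
    LinearMap.ker g = LinearMap.range (f 0) →
    (∀ i, LinearMap.ker (f i) = LinearMap.range (f (i+1))) →
    (∀ i ≥ N, Subsingleton (P i)) → HasProjectiveDimensionLT (ModuleCat.of Γ M) N := by
  induction N with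
  | zero =>
    intro P f M _ _ g _ hg _ _ h
    have := h 0 le_rfl
    have : Subsingleton M := hg.subsingleton
    have : Subsingleton (ModuleCat.of Γ M) := this
    exact (ModuleCat.isZero_of_subsingleton _).hasProjectiveDimensionLT_zero
  | succ N ih =>
    intro P f M _ _ g hP hg hgf hf h
    have h1 := ih (fun i => P (i + 1)) (fun i => f (i + 1)) (LinearMap.ker g)
      ((f 0).codRestrict _ (fun x => by rw [hgf]; exact ⟨x, rfl⟩)) (fun i => hP _) ?_ ?_
      (fun i => hf _) (fun i hi => h _ (by omega))
    · let S : ShortComplex (ModuleCat.{u} Γ) :=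
        { X₁ := ModuleCat.of Γ (LinearMap.ker g)
          X₂ := ModuleCat.of Γ (P 0)
          X₃ := ModuleCat.of Γ M
          f := ModuleCat.ofHom (LinearMap.ker g).subtype
          g := ModuleCat.ofHom g
          zero := by ext x; exact x.2 }
      have hS : S.ShortExact :=
        { exact := by
            rw [ShortComplex.ShortExact.moduleCat_exact_iff_function_exact]
            exact LinearMap.exact_subtype_ker_map g
          mono_f := (ModuleCat.mono_iff_injective _).2 (Submodule.subtype_injective _)
          epi_g := (ModuleCat.epi_iff_surjective _).2 hg }
      refine hS.hasProjectiveDimensionLT_X₃ N h1 ?_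
      have := hP 0
      have : Projective (ModuleCat.of Γ (P 0)) := IsProjective.iff_projective _ |>.1 this
      exact hasProjectiveDimensionLT_of_ge (ModuleCat.of Γ (P 0)) 1 (N + 1) (by omega)
    · intro y
      have : y.1 ∈ LinearMap.range (f 0) := hgf ▸ y.2
      obtain ⟨x, hx⟩ := this
      exact ⟨x, Subtype.ext hx⟩
    · rw [LinearMap.ker_codRestrict]
      exact hf 0

end pd

section ext1
variable {Λ : Type u} [Ring Λ] {e : Λ}
open MulOpposite

theorem ext1_vanish (hee : e * e = e) (h1 : ∀ l, e * l * (1 - e) ∈ Jset Λ)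
    (hJ : ∀ j ∈ Jset Λ, e * j * e ∈ Jsq Λ) : Ext1SelfVanishes Λ (SeMod Λ e) := by
  intro E _ _ i p hi hp hip
  let W := Submodule.span Λᵐᵒᵖ {x : eSub Λ e | (x : Λ) ∈ Jset Λ}
  have hmk0 : ∀ t : eSub Λ e, (t : Λ) ∈ Jset Λ → W.mkQ t = 0 := fun t ht =>
    (Submodule.Quotient.mk_eq_zero _).2 (Submodule.subset_span ht)
  have hSJ : ∀ (s : SeMod Λ e) (j : Λ), j ∈ Jset Λ → op j • s = 0 := by
    intro s j hj
    obtain ⟨t, rfl⟩ := W.mkQ_surjective s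
    rw [← map_smul]
    exact hmk0 _ (J_left hj t.1)
  have hSe : ∀ (s : SeMod Λ e), op e • s = s := by
    intro s
    obtain ⟨t, rfl⟩ := W.mkQ_surjective s
    have : op (1 - e) • W.mkQ t = 0 := by
      rw [← map_smul]
      refine hmk0 _ ?_
      change (t : Λ) * (1 - e) ∈ Jset Λ
      have ht : e * (t : Λ) = t := t.2
      rw [← ht]
      exact h1 _
    rw [MulOpposite.op_sub, sub_smul, MulOpposite.op_one, one_smul, sub_eq_zero] at this
    exact this.symm
  let eb : SeMod Λ e := W.mkQ ⟨e, hee⟩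
  have heb : ∀ t : eSub Λ e, op (t : Λ) • eb = W.mkQ t := by
    intro t
    change op (t : Λ) • W.mkQ ⟨e, hee⟩ = _
    rw [← map_smul]
    congr 1
    exact Subtype.ext t.2
  obtain ⟨x0, hx0⟩ := hp eb
  let x : E := op e • x0
  have hpx : p x = eb := by
    change p (op e • x0) = eb
    rw [map_smul, hx0, hSe]
  have hxe : op e • x = x := by
    change op e • op e • x0 = op e • x0
    rw [smul_smul, ← MulOpposite.op_mul, hee]
  have hJx : ∀ a ∈ Jset Λ, ∃ s, i s = op a • x := by
    intro a ha
    have : op a • x ∈ LinearMap.ker p := by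
      rw [LinearMap.mem_ker, map_smul, hSJ _ _ ha]
    rw [hip] at this
    exact this
  have hsq : ∀ z ∈ Jsq Λ, op z • x = 0 := by
    intro z hz
    induction hz using AddSubgroup.closure_induction with
    | mem z h =>
      obtain ⟨a, ha, b, hb, rfl⟩ := h
      obtain ⟨s, hs⟩ := hJx a ha
      rw [MulOpposite.op_mul, mul_smul, ← hs, ← map_smul, hSJ _ _ hb, map_zero]
    | zero => simp
    | add y z _ _ hy hz => rw [MulOpposite.op_add, add_smul, hy, hz, add_zero]
    | neg y _ hy => rw [MulOpposite.op_neg, neg_smul, hy, neg_zero]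
  have hj0 : ∀ j ∈ Jset Λ, op j • x = 0 := by
    intro j hj
    obtain ⟨s, hs⟩ := hJx j hj
    have h2 : op e • op j • x = op j • x := by rw [← hs, ← map_smul, hSe]
    rw [← h2, ← hxe, smul_smul, smul_smul, ← MulOpposite.op_mul, ← MulOpposite.op_mul, ← mul_assoc]
    exact hsq _ (hJ j hj)
  let s0 : eSub Λ e →ₗ[Λᵐᵒᵖ] E :=
    { toFun := fun t => op (t : Λ) • x
      map_add' := fun t t' => by
        rw [← add_smul, ← MulOpposite.op_add]; rfl
      map_smul' := fun c t => by
        exact mul_smul c (op (t : Λ)) x }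
  let s : SeMod Λ e →ₗ[Λᵐᵒᵖ] E := W.liftQ s0 (Submodule.span_le.2 fun t ht => hj0 _ ht)
  have hps : ∀ z, p (s z) = z := by
    intro z
    obtain ⟨t, rfl⟩ := W.mkQ_surjective z
    change p (op (t : Λ) • x) = _
    rw [map_smul, hpx, heb]
  have hex : Function.Exact i p := LinearMap.exact_iff.2 hip
  obtain ⟨r, hr⟩ := exists_lift i p hi hex (LinearMap.id - s ∘ₗ p) (fun y => by
    rw [LinearMap.sub_apply, LinearMap.comp_apply, map_sub, hps, LinearMap.id_apply, sub_self])
  refine ⟨r, fun z => hi ?_⟩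
  rw [hr, LinearMap.sub_apply, LinearMap.comp_apply, hex.apply_apply_eq_zero, map_zero,
    LinearMap.id_apply, sub_zero]

end ext1
end SNL

/-- Theorem 2.1 (projective case): let Λ be an artin algebra with radical J and e a basic
primitive idempotent such that eΛe/eJ²e is commutative (i.e. all commutators
exeye - eyexe lie in J²).  If S_e = eΛ/eJ has finite projective dimension, then
Ext¹_Λ(S_e, S_e) = 0. -/
theorem strong_no_loop_proj (k : Type u) [CommRing k] [IsArtinianRing k]
    (Λ : Type u) [Ring Λ] [Algebra k Λ] [Module.Finite k Λ]
    (e : Λ) (hbasic : IsBasicIdem e)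
    (hcomm : ∀ x y : Λ,
      (e * x * e) * (e * y * e) - (e * y * e) * (e * x * e) ∈ Jsq Λ)
    (hfin : FinProjDim Λ (SeMod Λ e)) :
    Ext1SelfVanishes Λ (SeMod Λ e) := by
  have hee : e * e = e := hbasic.1.2.1
  refine SNL.ext1_vanish hee (SNL.eJ1 k hbasic) fun j hj => ?_
  obtain ⟨R, _, _, π, hs, h1, h0⟩ := SNL.exists_quot k hbasic hcomm
  have : RingHomSurjective π := ⟨hs⟩
  have : IsNoetherianRing Λ := isNoetherian_of_tower k inferInstance
  have : IsNoetherianRing R := isNoetherianRing_of_surjective Λ R π hs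
  obtain ⟨P, f, g, hP, hg, hgf, hf, N, hN⟩ := hfin
  have hpd := SNL.pd_aux N P f (SeMod Λ e) g hP hg hgf hf hN
  obtain ⟨eq⟩ := SNL.eMap_equiv π k hbasic hs h1
  have hpd' : CategoryTheory.HasProjectiveDimensionLT (SNL.TR π) N :=
    CategoryTheory.hasProjectiveDimensionLT_of_iso eq.toModuleIso N
  refine h0 j (SNL.map_nilpotent_eq_zero N (fun M _ _ i hi => ?_) j (SNL.J_nilpotent k hj))
  exact CategoryTheory.HasProjectiveDimensionLT.subsingleton _ N i hi.le _
end

section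
/- Let Λ be a finite-dimensional algebra over a field k and S a simple right Λ-module that is one-dimensional over k. If S has finite projective dimension or finite injective dimension, then Ext¹_Λ(S, S) = 0. -/
universe u

open CategoryTheory TensorProduct

section StrongNoLoop

variable {k : Type u} [Field k] {R : Type u} [Ring R] [Algebra k R]

/-- A derivation of `R` with values in `End_k(A)`: it encodes a self-extension of `A`. -/
def IsDer {A : Type u} [AddCommGroup A] [Module k A] [Module R A] [IsScalarTower k R A]
    (D : R →ₗ[k] A →ₗ[k] A) : Prop :=
  ∀ (r s : R) (x : A), D (r * s) x = r • D s x + D r (s • x)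

section der
variable {A : Type u} [AddCommGroup A] [Module k A] [Module R A] [IsScalarTower k R A]

lemma IsDer.one {D : R →ₗ[k] A →ₗ[k] A} (hD : IsDer D) (x : A) : D 1 x = 0 := by
  have := hD 1 1 x
  simpa using this

/-- An inner derivation has trace zero. -/
lemma trace_inner [Module.Finite k A] (D : R →ₗ[k] A →ₗ[k] A) (h : A →ₗ[k] A)
    (hh : ∀ r x, D r x = h (r • x) - r • h x) (r : R) :
    LinearMap.trace k A (D r) = 0 := by
  have : D r = h ∘ₗ (Algebra.lsmul k k A r) - (Algebra.lsmul k k A r) ∘ₗ h := by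
    ext x; simp [hh]
  rw [this, map_sub, LinearMap.trace_comp_comm', sub_self]

variable (k R A) in
/-- The action map `R ⊗ A → A`. -/
noncomputable def actMap : R ⊗[k] A →ₗ[R] A :=
  TensorProduct.AlgebraTensorModule.lift
    (LinearMap.toSpanSingleton R (A →ₗ[k] A) LinearMap.id)

@[simp] lemma actMap_tmul (r : R) (x : A) : actMap k R A (r ⊗ₜ x) = r • x := by
  simp [actMap]

/-- The map `R ⊗ A → A` induced by `D`. -/
noncomputable def derMap (D : R →ₗ[k] A →ₗ[k] A) : R ⊗[k] A →ₗ[k] A := TensorProduct.lift D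

lemma derMap_smul {D : R →ₗ[k] A →ₗ[k] A} (hD : IsDer D) (r : R) (t : R ⊗[k] A) :
    derMap D (r • t) = r • derMap D t + D r (actMap k R A t) := by
  induction t with
  | zero => simp
  | tmul s x => simp [derMap, TensorProduct.smul_tmul', hD r s x]
  | add t u ht hu => rw [smul_add, map_add, map_add, map_add, map_add, ht, hu, smul_add]; abel

lemma actMap_surj : Function.Surjective (actMap k R A) := fun x => ⟨1 ⊗ₜ x, by simp⟩

/-- Base case, projective. -/
lemma trace_of_projective [Module.Finite k A] [Module.Projective R A]
    {D : R →ₗ[k] A →ₗ[k] A} (hD : IsDer D) (r : R) : LinearMap.trace k A (D r) = 0 := by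
  obtain ⟨s, hs⟩ := Module.projective_lifting_property (actMap k R A) LinearMap.id actMap_surj
  have hs' : ∀ x, actMap k R A (s x) = x := fun x => LinearMap.congr_fun hs x
  refine trace_inner D (derMap D ∘ₗ s.restrictScalars k) (fun r x => ?_) r
  simp [derMap_smul hD, hs']

variable (k R A) in
/-- The syzygy. -/
noncomputable abbrev Syz : Submodule R (R ⊗[k] A) := LinearMap.ker (actMap k R A)

/-- The map `x ↦ r ⊗ x - 1 ⊗ r x`. -/
noncomputable def syzIn : R →ₗ[k] A →ₗ[k] Syz k R A :=
  LinearMap.mk₂ k (fun r x => ⟨r ⊗ₜ x - 1 ⊗ₜ (r • x), by simp⟩)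
    (fun r s x => by ext; simp [TensorProduct.add_tmul, add_smul, TensorProduct.tmul_add]; abel)
    (fun c r x => by ext; simp [TensorProduct.smul_tmul', smul_sub])
    (fun r x y => by ext; simp [TensorProduct.tmul_add]; abel)
    (fun c r x => by
      ext; simp [smul_sub, smul_comm r c x])

@[simp] lemma syzIn_coe (r : R) (x : A) :
    ((syzIn (k := k) r x : Syz k R A) : R ⊗[k] A) = r ⊗ₜ x - 1 ⊗ₜ (r • x) := rfl

/-- `derMap` restricted to the syzygy. -/
noncomputable def syzOut (D : R →ₗ[k] A →ₗ[k] A) : Syz k R A →ₗ[k] A :=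
  derMap D ∘ₗ (Submodule.subtype (Syz k R A)).restrictScalars k

/-- The derivation on the syzygy. -/
noncomputable def syzDer (D : R →ₗ[k] A →ₗ[k] A) : R →ₗ[k] Syz k R A →ₗ[k] Syz k R A :=
  (LinearMap.lcomp k _ (syzOut D)) ∘ₗ syzIn

lemma syzDer_apply (D : R →ₗ[k] A →ₗ[k] A) (r : R) : syzDer D r = syzIn r ∘ₗ syzOut D := rfl

lemma syzDer_isDer {D : R →ₗ[k] A →ₗ[k] A} (hD : IsDer D) : IsDer (k := k) (R := R) (A := Syz k R A) (syzDer D) := by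
  intro r s t
  have ht : actMap k R A t = 0 := t.2
  have : syzOut D (s • t) = s • syzOut D t := by
    simp [syzOut, derMap_smul hD, ht]
  simp only [syzDer_apply, LinearMap.comp_apply, this]
  ext
  simp [smul_sub, TensorProduct.smul_tmul', mul_smul]

instance [Module.Finite k R] [Module.Finite k A] : Module.Finite k (Syz k R A) :=
  Module.Finite.of_injective ((Submodule.subtype (Syz k R A)).restrictScalars k)
    Subtype.val_injective

instance : Module.Free k (Syz k R A) := by
  exact Module.Free.of_divisionRing k (Syz k R A)

lemma syzDer_trace [Module.Finite k R] [Module.Finite k A]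
    {D : R →ₗ[k] A →ₗ[k] A} (hD : IsDer D) (r : R) :
    LinearMap.trace k _ (syzDer D r) = LinearMap.trace k _ (D r) := by
  rw [syzDer_apply, LinearMap.trace_comp_comm' (R := k) (M := Syz k R A) (N := A)]
  congr 1
  ext x
  simp [syzOut, derMap, hD.one]

end der

lemma trace_of_projDim [Module.Finite k R] (n : ℕ) :
    ∀ (A : Type u) [AddCommGroup A] [Module k A] [Module R A] [IsScalarTower k R A]
    [Module.Finite k A] (_ : HasProjectiveDimensionLT (ModuleCat.of R A) (n + 1))
    (D : R →ₗ[k] A →ₗ[k] A) (_ : IsDer D) (r : R), LinearMap.trace k A (D r) = 0 := by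
  induction n with
  | zero =>
    intro A _ _ _ _ _ h D hD r
    have : Projective (ModuleCat.of R A) := projective_iff_hasProjectiveDimensionLT_one.2 h
    have : Module.Projective R A := (IsProjective.iff_projective A).2 this
    exact trace_of_projective hD r
  | succ n ih =>
    intro A _ _ _ _ _ h D hD r
    rw [← syzDer_trace hD]
    refine ih _ ?_ _ (syzDer_isDer hD) r
    have hp : Projective (ModuleCat.of R (R ⊗[k] A)) :=
      (IsProjective.iff_projective (R ⊗[k] A)).1 inferInstance
    let T : ShortComplex (ModuleCat.{u} R) :=
      ShortComplex.moduleCatMk (X₁ := Syz k R A) (X₂ := R ⊗[k] A) (X₃ := A) (Submodule.subtype (Syz k R A))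
        (actMap k R A) (by
        refine LinearMap.ext fun x => ?_
        exact x.2)
    have hT : T.ShortExact :=
      { exact := (ShortComplex.moduleCat_exact_iff_range_eq_ker T).2 (Submodule.range_subtype _)
        mono_f := (ModuleCat.mono_iff_injective _).2 Subtype.val_injective
        epi_g := (ModuleCat.epi_iff_surjective _).2 (actMap_surj (k := k) (R := R) (A := A)) }
    exact (hT.hasProjectiveDimensionLT_X₃_iff n hp).1 h

lemma projDim_of_res (N : ℕ) :
    ∀ (M : Type u) [AddCommGroup M] [Module R M]
    (P : ℕ → ModuleCat.{u} R) (f : ∀ i, P (i+1) →ₗ[R] P i) (g : P 0 →ₗ[R] M)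
    (_ : ∀ i, Module.Projective R (P i)) (_ : Function.Surjective g)
    (_ : LinearMap.ker g = LinearMap.range (f 0))
    (_ : ∀ i, LinearMap.ker (f i) = LinearMap.range (f (i+1)))
    (_ : ∀ i ≥ N, Subsingleton (P i)), HasProjectiveDimensionLT (ModuleCat.of R M) (N + 1) := by
  induction N with
  | zero =>
    intro M _ _ P f g hP hg _ _ hN
    have := hN 0 le_rfl
    have : Subsingleton M := hg.subsingleton
    have : HasProjectiveDimensionLT (ModuleCat.of R M) 0 :=
      (ModuleCat.isZero_of_subsingleton (ModuleCat.of R M)).hasProjectiveDimensionLT_zero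
    infer_instance
  | succ N ih =>
    intro M _ _ P f g hP hg h0 hi hN
    have key := ih (LinearMap.ker g) (fun i => P (i+1)) (fun i => f (i+1))
      ((f 0).codRestrict (LinearMap.ker g) (fun x => h0 ▸ LinearMap.mem_range_self _ x))
      (fun i => hP _) (by
        rintro ⟨y, hy⟩
        rw [h0] at hy
        obtain ⟨x, rfl⟩ := hy
        exact ⟨x, rfl⟩)
      (by rw [LinearMap.ker_codRestrict, hi 0]) (fun i => hi _) (fun i h => hN _ (by omega))
    have hp : Projective (P 0) := (IsProjective.iff_projective (P 0)).1 (hP 0)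
    let T : ShortComplex (ModuleCat.{u} R) :=
      ShortComplex.moduleCatMk (Submodule.subtype (LinearMap.ker g)) g (by ext x; exact x.2)
    have hT : T.ShortExact :=
      { exact := (ShortComplex.moduleCat_exact_iff_range_eq_ker T).2 (Submodule.range_subtype _)
        mono_f := (ModuleCat.mono_iff_injective _).2 Subtype.val_injective
        epi_g := (ModuleCat.epi_iff_surjective _).2 hg }
    exact (hT.hasProjectiveDimensionLT_X₃_iff N hp).2 key

variable (k R) in
/-- The coinduced module `Hom_k(R, A)`. -/
def CoInd (A : Type u) [AddCommGroup A] [Module k A] : Type u := R →ₗ[k] A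

section coind
variable {A : Type u} [AddCommGroup A] [Module k A]

instance : AddCommGroup (CoInd k R A) := inferInstanceAs (AddCommGroup (R →ₗ[k] A))
instance : Module k (CoInd k R A) := inferInstanceAs (Module k (R →ₗ[k] A))
instance : FunLike (CoInd k R A) R A := inferInstanceAs (FunLike (R →ₗ[k] A) R A)

@[ext] lemma CoInd.ext {f g : CoInd k R A} (h : ∀ r, f r = g r) : f = g := LinearMap.ext h
@[simp] lemma CoInd.add_apply (f g : CoInd k R A) (r : R) : (f + g) r = f r + g r := rfl
@[simp] lemma CoInd.zero_apply (r : R) : (0 : CoInd k R A) r = 0 := rfl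
@[simp] lemma CoInd.smulk_apply (c : k) (f : CoInd k R A) (r : R) : (c • f) r = c • f r := rfl
lemma CoInd.map_add' (f : CoInd k R A) (r s : R) : f (r + s) = f r + f s :=
  LinearMap.map_add (f : R →ₗ[k] A) r s
lemma CoInd.map_smul' (f : CoInd k R A) (c : k) (s : R) : f (c • s) = c • f s :=
  LinearMap.map_smul (f : R →ₗ[k] A) c s
lemma CoInd.map_zero' (f : CoInd k R A) : f 0 = 0 :=
  LinearMap.map_zero (f : R →ₗ[k] A)

instance : SMul R (CoInd k R A) :=
  ⟨fun s f => (LinearMap.comp (f : R →ₗ[k] A) (LinearMap.mulRight k s) : R →ₗ[k] A)⟩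

@[simp] lemma CoInd.smul_apply (s : R) (f : CoInd k R A) (r : R) : (s • f) r = f (r * s) := rfl

instance : Module R (CoInd k R A) where
  one_smul f := by ext r; simp
  mul_smul s t f := by ext r; simp [mul_assoc]
  smul_zero s := by ext r; simp
  smul_add s f g := by ext r; simp
  add_smul s t f := by ext r; simp [mul_add, CoInd.map_add']
  zero_smul f := by ext r; simp [CoInd.map_zero']

instance : IsScalarTower k R (CoInd k R A) :=
  ⟨fun c s f => by ext r; simp [CoInd.map_smul']⟩

instance [Module.Finite k R] [Module.Finite k A] : Module.Finite k (CoInd k R A) :=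
  inferInstanceAs (Module.Finite k (R →ₗ[k] A))

instance : Module.Injective R (CoInd k R A) where
  out X Y _ _ _ _ f hf g := by
    letI : Module k X := Module.compHom X (algebraMap k R)
    letI : Module k Y := Module.compHom Y (algebraMap k R)
    haveI : IsScalarTower k R X := IsScalarTower.of_algebraMap_smul fun _ _ => rfl
    haveI : IsScalarTower k R Y := IsScalarTower.of_algebraMap_smul fun _ _ => rfl
    obtain ⟨q, hq⟩ := LinearMap.exists_leftInverse_of_injective (f.restrictScalars k)
      (LinearMap.ker_eq_bot.2 hf)
    have hq' : ∀ x, q (f x) = x := fun x => LinearMap.congr_fun hq x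
    let G : Y → CoInd k R A := fun y => (
      { toFun := fun r => g (q (r • y)) 1
        map_add' := fun r s => by simp [add_smul]
        map_smul' := fun c r => by
          rw [smul_assoc, map_smul, ← algebraMap_smul R c (q (r • y)), map_smul,
            algebraMap_smul]
          rfl } : R →ₗ[k] A)
    have hG : ∀ y r, G y r = g (q (r • y)) 1 := fun _ _ => rfl
    refine ⟨{ toFun := G, map_add' := fun y z => ?_, map_smul' := fun s y => ?_ }, fun x => ?_⟩
    · ext r; simp [hG]
    · ext r; simp [hG, mul_smul]
    · ext r
      change G (f x) r = _
      rw [hG, ← map_smul, hq', map_smul]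
      simp

variable [Module R A] [IsScalarTower k R A]

variable (k R A) in
/-- The embedding `A → Hom_k(R, A)`. -/
def coMap : A →ₗ[R] CoInd k R A where
  toFun x := ((LinearMap.toSpanSingleton R A x).restrictScalars k : R →ₗ[k] A)
  map_add' x y := by ext r; exact smul_add r x y
  map_smul' s x := by ext r; exact (mul_smul r s x).symm

@[simp] lemma coMap_apply (x : A) (r : R) : coMap k R A x r = r • x := rfl

lemma coMap_inj : Function.Injective (coMap k R A) := fun x y h => by
  have := congrArg (fun f : CoInd k R A => f 1) h
  simpa using this

/-- The map `A → Hom_k(R, A)` induced by `D`. -/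
def coDer (D : R →ₗ[k] A →ₗ[k] A) : A →ₗ[k] CoInd k R A := D.flip

@[simp] lemma coDer_apply (D : R →ₗ[k] A →ₗ[k] A) (x : A) (r : R) : coDer D x r = D r x := rfl

lemma coDer_smul {D : R →ₗ[k] A →ₗ[k] A} (hD : IsDer D) (r : R) (x : A) :
    r • coDer D x = coMap k R A (D r x) + coDer D (r • x) := by
  ext t; simp [hD t r x]

/-- Base case, injective. -/
lemma trace_of_injective [Module.Finite k A] [hI : Module.Injective R A]
    {D : R →ₗ[k] A →ₗ[k] A} (hD : IsDer D) (r : R) : LinearMap.trace k A (D r) = 0 := by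
  obtain ⟨p, hp⟩ := hI.out (coMap k R A) coMap_inj LinearMap.id
  refine trace_inner D (-(p.restrictScalars k ∘ₗ coDer D)) (fun r x => ?_) r
  have h1 := congrArg p (coDer_smul hD r x)
  rw [map_add, hp, map_smul] at h1
  simp [h1]

variable (k R A) in
/-- The cosyzygy. -/
abbrev Cosyz := CoInd k R A ⧸ LinearMap.range (coMap k R A)

/-- The map `f ↦ r f(1) - f(r)` on the cosyzygy. -/
def cosyzOut : R →ₗ[k] Cosyz k R A →ₗ[k] A :=
  LinearMap.mk₂ k (fun r f => Quotient.liftOn' f (fun f => r • f 1 - f r) (by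
      intro f g h
      rw [Submodule.quotientRel_def] at h
      obtain ⟨x, hx⟩ := h
      have hf : f = g + coMap k R A x := by rw [hx]; abel
      subst hf
      simp))
    (fun r s f => by
      induction f using Submodule.Quotient.induction_on with | _ f
      change (r + s) • f 1 - f (r + s) = (r • f 1 - f r) + (s • f 1 - f s)
      rw [CoInd.map_add', add_smul]; abel)
    (fun c r f => by
      induction f using Submodule.Quotient.induction_on with | _ f
      change (c • r) • f 1 - f (c • r) = c • (r • f 1 - f r)
      rw [CoInd.map_smul', smul_assoc, smul_sub])
    (fun r f g => by
      induction f using Submodule.Quotient.induction_on with | _ f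
      induction g using Submodule.Quotient.induction_on with | _ g
      change r • (f 1 + g 1) - (f r + g r) = (r • f 1 - f r) + (r • g 1 - g r)
      rw [smul_add]; abel)
    (fun c r f => by
      induction f using Submodule.Quotient.induction_on with | _ f
      change r • (c • f 1) - c • f r = c • (r • f 1 - f r)
      rw [smul_sub, smul_comm r c])

lemma cosyzOut_mk (r : R) (f : CoInd k R A) :
    cosyzOut r (Submodule.Quotient.mk f : Cosyz k R A) = r • f 1 - f r := rfl

/-- `coDer` projected to the cosyzygy. -/
def cosyzIn (D : R →ₗ[k] A →ₗ[k] A) : A →ₗ[k] Cosyz k R A :=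
  (Submodule.mkQ (LinearMap.range (coMap k R A))).restrictScalars k ∘ₗ coDer D

lemma cosyzIn_apply (D : R →ₗ[k] A →ₗ[k] A) (x : A) :
    cosyzIn D x = Submodule.Quotient.mk (coDer D x) := rfl

lemma cosyzIn_smul {D : R →ₗ[k] A →ₗ[k] A} (hD : IsDer D) (r : R) (x : A) :
    r • cosyzIn D x = cosyzIn D (r • x) := by
  rw [cosyzIn_apply, cosyzIn_apply, ← Submodule.Quotient.mk_smul, coDer_smul hD,
    Submodule.Quotient.mk_add, (Submodule.Quotient.mk_eq_zero _).2 (LinearMap.mem_range_self _ _),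
    zero_add]

/-- The derivation on the cosyzygy. -/
def cosyzDer (D : R →ₗ[k] A →ₗ[k] A) : R →ₗ[k] Cosyz k R A →ₗ[k] Cosyz k R A :=
  (LinearMap.compRight k (cosyzIn D)) ∘ₗ cosyzOut

lemma cosyzDer_apply (D : R →ₗ[k] A →ₗ[k] A) (r : R) :
    cosyzDer D r = cosyzIn D ∘ₗ cosyzOut r := rfl

lemma cosyzDer_isDer {D : R →ₗ[k] A →ₗ[k] A} (hD : IsDer D) :
    IsDer (k := k) (R := R) (A := Cosyz k R A) (cosyzDer D) := by
  intro r s f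
  induction f using Submodule.Quotient.induction_on with | _ f
  simp only [cosyzDer_apply, LinearMap.comp_apply]
  rw [cosyzIn_smul hD, ← Submodule.Quotient.mk_smul, cosyzOut_mk, cosyzOut_mk, cosyzOut_mk,
    ← map_add]
  congr 1
  simp [smul_sub, mul_smul]

lemma cosyzDer_trace [Module.Finite k R] [Module.Finite k A]
    {D : R →ₗ[k] A →ₗ[k] A} (hD : IsDer D) (r : R) :
    LinearMap.trace k _ (cosyzDer D r) = - LinearMap.trace k _ (D r) := by
  rw [cosyzDer_apply, LinearMap.trace_comp_comm' (R := k) (N := A) (M := Cosyz k R A), ← map_neg]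
  congr 1
  ext x
  simp [cosyzIn_apply, cosyzOut_mk, hD.one]

end coind

lemma trace_of_injDim [Module.Finite k R] (n : ℕ) :
    ∀ (A : Type u) [AddCommGroup A] [Module k A] [Module R A] [IsScalarTower k R A]
    [Module.Finite k A] (_ : HasInjectiveDimensionLT (ModuleCat.of R A) (n + 1))
    (D : R →ₗ[k] A →ₗ[k] A) (_ : IsDer D) (r : R), LinearMap.trace k A (D r) = 0 := by
  induction n with
  | zero =>
    intro A _ _ _ _ _ h D hD r
    have : Injective (ModuleCat.of R A) := injective_iff_hasInjectiveDimensionLT_one.2 h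
    have : Module.Injective R A := (Module.injective_iff_injective_object R A).2 this
    exact trace_of_injective hD r
  | succ n ih =>
    intro A _ _ _ _ _ h D hD r
    rw [← neg_eq_zero, ← cosyzDer_trace hD]
    refine ih _ ?_ _ (cosyzDer_isDer hD) r
    have hp : Injective (ModuleCat.of R (CoInd k R A)) :=
      (Module.injective_iff_injective_object R _).1 inferInstance
    let T : ShortComplex (ModuleCat.{u} R) :=
      ShortComplex.moduleCatMk (coMap k R A) (Submodule.mkQ (LinearMap.range (coMap k R A)))
        (by ext x; simp)
    have hT : T.ShortExact :=
      { exact := (ShortComplex.moduleCat_exact_iff_range_eq_ker T).2 (Submodule.ker_mkQ _).symm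
        mono_f := (ModuleCat.mono_iff_injective _).2 (coMap_inj (k := k) (R := R) (A := A))
        epi_g := (ModuleCat.epi_iff_surjective _).2 (Submodule.mkQ_surjective _) }
    exact (hT.hasInjectiveDimensionLT_X₃_iff n hp).2 h

lemma injDim_of_res (N : ℕ) :
    ∀ (M : Type u) [AddCommGroup M] [Module R M]
    (I : ℕ → ModuleCat.{u} R) (f : ∀ i, I i →ₗ[R] I (i+1)) (g : M →ₗ[R] I 0)
    (_ : ∀ i, Module.Injective R (I i)) (_ : Function.Injective g)
    (_ : LinearMap.ker (f 0) = LinearMap.range g)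
    (_ : ∀ i, LinearMap.ker (f (i+1)) = LinearMap.range (f i))
    (_ : ∀ i ≥ N, Subsingleton (I i)), HasInjectiveDimensionLT (ModuleCat.of R M) (N + 1) := by
  induction N with
  | zero =>
    intro M _ _ P f g hP hg _ _ hN
    have := hN 0 le_rfl
    have : Subsingleton M := hg.subsingleton
    have : HasInjectiveDimensionLT (ModuleCat.of R M) 0 :=
      (ModuleCat.isZero_of_subsingleton (ModuleCat.of R M)).hasInjectiveDimensionLT_zero
    infer_instance
  | succ N ih =>
    intro M _ _ P f g hP hg h0 hi hN
    have key := ih (P 0 ⧸ LinearMap.range g) (fun i => P (i+1)) (fun i => f (i+1))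
      ((LinearMap.range g).liftQ (f 0) h0.ge)
      (fun i => hP _) (by
        rw [← LinearMap.ker_eq_bot]
        exact Submodule.ker_liftQ_eq_bot _ _ _ h0.le)
      (by rw [Submodule.range_liftQ, hi 0]) (fun i => hi _) (fun i h => hN _ (by omega))
    have hp : Injective (P 0) := (Module.injective_iff_injective_object R (P 0)).1 (hP 0)
    let T : ShortComplex (ModuleCat.{u} R) :=
      ShortComplex.moduleCatMk g (Submodule.mkQ (LinearMap.range g)) (by ext x; simp)
    have hT : T.ShortExact :=
      { exact := (ShortComplex.moduleCat_exact_iff_range_eq_ker T).2 (Submodule.ker_mkQ _).symm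
        mono_f := (ModuleCat.mono_iff_injective _).2 hg
        epi_g := (ModuleCat.epi_iff_surjective _).2 (Submodule.mkQ_surjective _) }
    exact (hT.hasInjectiveDimensionLT_X₃_iff N hp).1 key

/-- If all derivations into `End_k S` have trace zero and `S` is one-dimensional, then
self-extensions split. -/
lemma split_of_trace {S E : Type u} [AddCommGroup S] [Module k S] [Module R S]
    [IsScalarTower k R S] [Module.Finite k S] [AddCommGroup E] [Module R E]
    (x₀ : S) (hx₀ : ∀ y : S, ∃ c : k, y = c • x₀) (hne : Nontrivial S)
    (htr : ∀ D : R →ₗ[k] S →ₗ[k] S, IsDer D → ∀ r, LinearMap.trace k S (D r) = 0)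
    (i : S →ₗ[R] E) (p : E →ₗ[R] S) (hi : Function.Injective i) (hp : Function.Surjective p)
    (hex : LinearMap.ker p = LinearMap.range i) :
    ∃ r : E →ₗ[R] S, ∀ x, r (i x) = x := by
  letI : Module k E := Module.compHom E (algebraMap k R)
  haveI : IsScalarTower k R E := IsScalarTower.of_algebraMap_smul fun _ _ => rfl
  obtain ⟨q, hq⟩ := LinearMap.exists_leftInverse_of_injective (i.restrictScalars k)
    (LinearMap.ker_eq_bot.2 hi)
  have hq' : ∀ x, q (i x) = x := fun x => LinearMap.congr_fun hq x
  obtain ⟨σ, hσ⟩ := LinearMap.exists_rightInverse_of_surjective (p.restrictScalars k)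
    (LinearMap.range_eq_top.2 hp)
  have hσ' : ∀ x, p (σ x) = x := fun x => LinearMap.congr_fun hσ x
  let D : R →ₗ[k] S →ₗ[k] S := LinearMap.mk₂ k (fun r x => q (r • σ x) - r • q (σ x))
    (fun r s x => by simp only [add_smul, map_add]; abel)
    (fun c r x => by simp only [smul_assoc, map_smul, smul_sub])
    (fun r x y => by simp only [smul_add, map_add]; abel)
    (fun c r x => by simp only [map_smul, smul_comm r c, smul_sub])
  have hDa : ∀ r x, D r x = q (r • σ x) - r • q (σ x) := fun _ _ => rfl
  have key : ∀ r y, q (r • y) - r • q y = D r (p y) := by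
    intro r y
    have : y - σ (p y) ∈ LinearMap.range i := by
      rw [← hex, LinearMap.mem_ker, map_sub, hσ', sub_self]
    obtain ⟨z, hz⟩ := this
    have hy : y = σ (p y) + i z := by rw [hz]; abel
    have e1 : q (r • y) = q (r • σ (p y)) + r • z := by
      conv_lhs => rw [hy]
      rw [smul_add, map_add, ← i.map_smul, hq']
    have e2 : q y = q (σ (p y)) + z := by
      conv_lhs => rw [hy]
      rw [map_add, hq']
    rw [e1, e2, hDa, smul_add]; abel
  have hD : IsDer D := by
    intro r s x
    have h1 := key r (s • σ x)
    rw [p.map_smul, hσ'] at h1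
    rw [← h1, hDa, hDa, smul_sub, mul_smul, mul_smul]; abel
  have h0 : ∀ r x, D r x = 0 := by
    intro r
    have hx0 : x₀ ≠ 0 := by
      rintro rfl
      obtain ⟨y, hy⟩ := exists_ne (0 : S)
      obtain ⟨c, hc⟩ := hx₀ y
      exact hy (by simpa using hc)
    obtain ⟨d, hd⟩ := hx₀ (D r x₀)
    have hDd : D r = d • LinearMap.id := by
      ext y
      obtain ⟨c, rfl⟩ := hx₀ y
      simp [hd, smul_comm c d]
    have hrank : Module.finrank k S = 1 :=
      finrank_eq_one x₀ hx0 (fun w => by obtain ⟨c, hc⟩ := hx₀ w; exact ⟨c, hc.symm⟩)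
    have := htr D hD r
    rw [hDd, map_smul, LinearMap.trace_id, hrank] at this
    have hd0 : d = 0 := by simpa using this
    intro x
    rw [hDd, hd0]; simp
  refine ⟨{ toFun := q, map_add' := map_add q, map_smul' := fun r y => ?_ }, hq'⟩
  have := key r y
  rw [h0, sub_eq_zero] at this
  exact this

end StrongNoLoop

/-- Theorem 2.2: let Λ be a finite dimensional algebra over a field k and S a simple
right Λ-module which is one dimensional over k (k acting through the algebra map
k → Λ).  If S has finite projective or injective dimension, then Ext¹_Λ(S, S) = 0. -/
theorem strong_no_loop_one_dimensional (k : Type u) [Field k]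
    (Λ : Type u) [Ring Λ] [Algebra k Λ] [FiniteDimensional k Λ]
    (S : Type u) [AddCommGroup S] [Module Λᵐᵒᵖ S] [IsSimpleModule Λᵐᵒᵖ S]
    (honedim : ∃ x : S, ∀ y : S, ∃ c : k,
      y = (MulOpposite.op (algebraMap k Λ c)) • x)
    (hfin : FinProjDim Λ S ∨ FinInjDim Λ S) :
    Ext1SelfVanishes Λ S := by
  obtain ⟨x₀, hx₀⟩ := honedim
  letI : Module k S := Module.compHom S (algebraMap k Λᵐᵒᵖ)
  haveI : IsScalarTower k Λᵐᵒᵖ S := IsScalarTower.of_algebraMap_smul fun _ _ => rfl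
  have hx₁ : ∀ y : S, ∃ c : k, y = c • x₀ := fun y => hx₀ y
  haveI : Module.Finite k Λᵐᵒᵖ := Module.Finite.equiv (MulOpposite.opLinearEquiv k)
  haveI : Module.Finite k S := ⟨⟨{x₀}, by
    rw [eq_top_iff]
    intro y _
    obtain ⟨c, rfl⟩ := hx₁ y
    exact Submodule.smul_mem _ _ (Submodule.subset_span (by simp))⟩⟩
  intro E _ _ i p hi hp hex
  refine split_of_trace (k := k) x₀ hx₁ (IsSimpleModule.nontrivial Λᵐᵒᵖ S) ?_ i p hi hp hex
  intro D hD r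
  rcases hfin with h | h
  · obtain ⟨P, f, g, h1, h2, h3, h4, N, h5⟩ := h
    exact trace_of_projDim N S (projDim_of_res N S P f g h1 h2 h3 h4 h5) D hD r
  · obtain ⟨P, f, g, h1, h2, h3, h4, N, h5⟩ := h
    exact trace_of_injDim N S (injDim_of_res N S P f g h1 h2 h3 h4 h5) D hD r
end

section
/- Let Λ be a finite-dimensional elementary algebra over a field k (i.e., every simple Λ-module is one-dimensional over k) of finite global dimension. Then Ext¹_Λ(S, S) = 0 for every simple Λ-module S; equivalently, the extension quiver of Λ has no loops. -/
universe u

namespace NoLoop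

open CategoryTheory TensorProduct

section Trace
variable {R : Type u} [Ring R] {A : Type u} [AddCommGroup A] (t : R →+ A)

/-- Trace on free modules. -/
def T0 {m : ℕ} (g : (Fin m → R) →ₗ[R] (Fin m → R)) : A :=
  ∑ j, t (g (Pi.single j 1) j)

theorem apply_eq_sum {m n : ℕ} (h : (Fin m → R) →ₗ[R] (Fin n → R)) (v : Fin m → R) (j : Fin n) :
    h v j = ∑ p, v p * h (Pi.single p 1) j := by
  conv_lhs => rw [LinearMap.pi_apply_eq_sum_univ h v]
  simp only [Finset.sum_apply, Pi.smul_apply, smul_eq_mul]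
  refine Finset.sum_congr rfl fun p _ => ?_
  have : (fun j => if p = j then (1 : R) else 0) = Pi.single p 1 := by
    ext i
    simp [Pi.single_apply, eq_comm]
  rw [this]

theorem T0_comm (ht : ∀ a b, t (a * b) = t (b * a)) {m n : ℕ}
    (g : (Fin m → R) →ₗ[R] (Fin n → R)) (h : (Fin n → R) →ₗ[R] (Fin m → R)) :
    T0 t (h ∘ₗ g) = T0 t (g ∘ₗ h) := by
  unfold T0
  simp only [LinearMap.comp_apply]
  simp only [apply_eq_sum h (g _), apply_eq_sum g (h _), map_sum]
  rw [Finset.sum_comm]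
  refine Finset.sum_congr rfl fun i _ => Finset.sum_congr rfl fun j _ => ht _ _

variable (P : Type u) [AddCommGroup P] [Module R P]
variable (Q : Type u) [AddCommGroup Q] [Module R Q]

theorem exists_dual [Module.Finite R P] [Module.Projective R P] :
    ∃ (m : ℕ) (q : (Fin m → R) →ₗ[R] P) (i : P →ₗ[R] (Fin m → R)), q ∘ₗ i = LinearMap.id := by
  obtain ⟨m, q, i, _, _, h⟩ := Module.Finite.exists_comp_eq_id_of_projective R P
  exact ⟨m, q, i, h⟩

/-- Hattori-Stallings trace. -/
noncomputable def tr [Module.Finite R P] [Module.Projective R P] (f : P →ₗ[R] P) : A :=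
  T0 t ((exists_dual (R := R) P).choose_spec.choose_spec.choose ∘ₗ f ∘ₗ
    (exists_dual (R := R) P).choose_spec.choose)

variable {P Q}

theorem tr_eq (ht : ∀ a b, t (a * b) = t (b * a)) [Module.Finite R P] [Module.Projective R P]
    (f : P →ₗ[R] P) {m : ℕ} (q : (Fin m → R) →ₗ[R] P) (i : P →ₗ[R] (Fin m → R))
    (h : q ∘ₗ i = LinearMap.id) : tr t P f = T0 t (i ∘ₗ f ∘ₗ q) := by
  obtain ⟨m', q', i', e, h'⟩ : ∃ (m' : ℕ) (q' : (Fin m' → R) →ₗ[R] P)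
      (i' : P →ₗ[R] (Fin m' → R)), q' ∘ₗ i' = LinearMap.id ∧
      tr t P f = T0 t (i' ∘ₗ f ∘ₗ q') :=
    ⟨_, _, _, (exists_dual (R := R) P).choose_spec.choose_spec.choose_spec, rfl⟩
  rw [h']
  have e1 : i' ∘ₗ f ∘ₗ q' = (i' ∘ₗ q) ∘ₗ (i ∘ₗ f ∘ₗ q') := by
    have e3 (y) : q (i y) = y := LinearMap.congr_fun h y
    apply LinearMap.ext
    intro x
    simp [e3]
  rw [e1, T0_comm t ht]
  congr 1
  have e2 (y) : q' (i' y) = y := LinearMap.congr_fun e y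
  apply LinearMap.ext
  intro x
  simp [e2]

theorem tr_comm (ht : ∀ a b, t (a * b) = t (b * a)) [Module.Finite R P] [Module.Projective R P]
    [Module.Finite R Q] [Module.Projective R Q] (f : P →ₗ[R] Q) (g : Q →ₗ[R] P) :
    tr t P (g ∘ₗ f) = tr t Q (f ∘ₗ g) := by
  obtain ⟨m, q, i, h⟩ := exists_dual (R := R) P
  obtain ⟨m', q', i', h'⟩ := exists_dual (R := R) Q
  rw [tr_eq t ht _ q i h, tr_eq t ht _ q' i' h']
  have e (y) : q (i y) = y := LinearMap.congr_fun h y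
  have e' (y) : q' (i' y) = y := LinearMap.congr_fun h' y
  have := T0_comm t ht (i' ∘ₗ f ∘ₗ q) (i ∘ₗ g ∘ₗ q')
  convert this using 2 <;> (apply LinearMap.ext; intro x; simp [e, e'])

theorem tr_add [Module.Finite R P] [Module.Projective R P] (f g : P →ₗ[R] P) :
    tr t P (f + g) = tr t P f + tr t P g := by
  simp [tr, T0, Finset.sum_add_distrib]

theorem tr_zero [Module.Finite R P] [Module.Projective R P] :
    tr t P 0 = 0 := by
  simp [tr, T0]

theorem tr_exact (ht : ∀ a b, t (a * b) = t (b * a))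
    {P' P P'' : Type u} [AddCommGroup P'] [Module R P'] [AddCommGroup P] [Module R P]
    [AddCommGroup P''] [Module R P'']
    [Module.Finite R P'] [Module.Projective R P'] [Module.Finite R P] [Module.Projective R P]
    [Module.Finite R P''] [Module.Projective R P'']
    (f' : P' →ₗ[R] P') (f : P →ₗ[R] P) (f'' : P'' →ₗ[R] P'')
    (ι : P' →ₗ[R] P) (π : P →ₗ[R] P'') (hι : Function.Injective ι) (hπ : Function.Surjective π)
    (hex : Function.Exact ι π) (h1 : f ∘ₗ ι = ι ∘ₗ f') (h2 : π ∘ₗ f = f'' ∘ₗ π) :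
    tr t P f = tr t P' f' + tr t P'' f'' := by
  obtain ⟨s, hs⟩ := Module.projective_lifting_property π LinearMap.id hπ
  have hs' (y) : π (s y) = y := LinearMap.congr_fun hs y
  have key : ∀ x : P, ∃ y : P', ι y = x - s (π x) := fun x => by
    apply (hex _).1
    simp [hs']
  choose r hr using key
  let r' : P →ₗ[R] P' :=
    { toFun := r
      map_add' := fun x y => hι (by simp only [map_add, hr]; abel)
      map_smul' := fun c x => hι (by simp [hr, smul_sub]) }
  have hr' (x) : ι (r' x) = x - s (π x) := hr x
  have hrι (x) : r' (ι x) = x := hι (by rw [hr', hex.apply_apply_eq_zero]; simp)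
  have h1' (x) : f (ι x) = ι (f' x) := LinearMap.congr_fun h1 x
  have h2' (x) : π (f x) = f'' (π x) := LinearMap.congr_fun h2 x
  have e : f = (f ∘ₗ ι) ∘ₗ r' + (f ∘ₗ s) ∘ₗ π := by
    ext x
    simp [hr']
  rw [e, tr_add, tr_comm t ht r', tr_comm t ht π]
  congr 2
  · ext x; simp [h1', hrι]
  · ext x; simp [h2', hs']

end Trace

section PD
variable {R : Type u} [Ring R]

abbrev PD (n : ℕ) (M : Type u) [AddCommGroup M] [Module R M] : Prop :=
  HasProjectiveDimensionLT (ModuleCat.of R M) n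

theorem proj_iff (M : Type u) [AddCommGroup M] [Module R M] :
    PD (R := R) 1 M ↔ Module.Projective R M := by
  rw [PD, ← projective_iff_hasProjectiveDimensionLT_one, ← IsProjective.iff_projective]

theorem PD_ker_iff {P M : Type u} [AddCommGroup M] [Module R M] [AddCommGroup P] [Module R P]
    [Module.Projective R P] (g : P →ₗ[R] M) (hg : Function.Surjective g) (n : ℕ) :
    PD (R := R) (n + 2) M ↔ PD (R := R) (n + 1) (LinearMap.ker g) := by
  have hS : (g.shortComplexKer).ShortExact := g.shortExact_shortComplexKer hg
  have : Projective (ModuleCat.of R P) := (IsProjective.iff_projective P).1 inferInstance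
  exact hS.hasProjectiveDimensionLT_X₃_iff n this

theorem PD_of_res (N : ℕ) : ∀ (M : Type u) [AddCommGroup M] [Module R M]
    (P : ℕ → ModuleCat.{u} R) (f : ∀ i, P (i+1) →ₗ[R] P i) (g : P 0 →ₗ[R] M),
    (∀ i, Module.Projective R (P i)) → Function.Surjective g →
    LinearMap.ker g = LinearMap.range (f 0) →
    (∀ i, LinearMap.ker (f i) = LinearMap.range (f (i+1))) →
    (∀ i ≥ N, Subsingleton (P i)) → PD (R := R) (N + 1) M := by
  induction N with
  | zero =>
    intro M _ _ P f g _ hg _ _ hN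
    have := hN 0 le_rfl
    have : Subsingleton M := hg.subsingleton
    rw [zero_add, proj_iff]
    infer_instance
  | succ N ih =>
    intro M _ _ P f g hP hg h0 h hN
    have := hP 0
    rw [add_assoc, PD_ker_iff g hg]
    have hm (x) : f 0 x ∈ LinearMap.ker g := h0 ▸ ⟨x, rfl⟩
    refine ih (LinearMap.ker g) (fun i => P (i + 1)) (fun i => f (i + 1))
      ((f 0).codRestrict _ hm) (fun i => hP _) ?_ ?_ (fun i => h _) (fun i hi => hN _ (by omega))
    · rintro ⟨x, hx⟩
      rw [h0] at hx
      obtain ⟨y, rfl⟩ := hx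
      exact ⟨y, rfl⟩
    · rw [LinearMap.ker_codRestrict, h]

end PD

section Bar
variable (k : Type u) [Field k] (R : Type u) [Ring R] [Algebra k R]

/-- The action map. -/
noncomputable def act (M : Type u) [AddCommGroup M] [Module k M] [Module R M]
    [IsScalarTower k R M] : R ⊗[k] M →ₗ[R] M :=
  TensorProduct.AlgebraTensorModule.lift
    { toFun := fun r => 
        { toFun := fun m => r • m
          map_add' := smul_add r
          map_smul' := fun c m => smul_comm r c m }
      map_add' := fun a b => by ext; simp [add_smul]
      map_smul' := fun a b => by ext; simp [mul_smul] }

theorem act_tmul (M : Type u) [AddCommGroup M] [Module k M] [Module R M]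
    [IsScalarTower k R M] (r : R) (m : M) : act k R M (r ⊗ₜ m) = r • m := rfl

theorem act_surj (M : Type u) [AddCommGroup M] [Module k M] [Module R M]
    [IsScalarTower k R M] : Function.Surjective (act k R M) :=
  fun m => ⟨1 ⊗ₜ m, by simp [act_tmul]⟩

noncomputable abbrev Om (M : Type u) [AddCommGroup M] [Module k M] [Module R M]
    [IsScalarTower k R M] := LinearMap.ker (act k R M)

section maps
variable {M N : Type u} [AddCommGroup M] [Module k M] [Module R M] [IsScalarTower k R M]
  [AddCommGroup N] [Module k N] [Module R N] [IsScalarTower k R N]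
variable {M' : Type u} [AddCommGroup M'] [Module k M'] [Module R M'] [IsScalarTower k R M']

noncomputable def Bm (f : M →ₗ[R] N) : R ⊗[k] M →ₗ[R] R ⊗[k] N :=
  LinearMap.baseChange R (f.restrictScalars k)

variable {R}
theorem act_Bm (f : M →ₗ[R] N) (z : R ⊗[k] M) : act k R N (Bm k R f z) = f (act k R M z) := by
  induction z with
  | zero => simp
  | add x y hx hy => simp [hx, hy]
  | tmul r m => simp [act_tmul, Bm]

theorem Bm_inj (f : M →ₗ[R] N) (hf : Function.Injective f) : Function.Injective (Bm k R f) :=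
  Module.Flat.lTensor_preserves_injective_linearMap (M := R) (f.restrictScalars k) hf

theorem Bm_surj (f : M →ₗ[R] N) (hf : Function.Surjective f) : Function.Surjective (Bm k R f) :=
  LinearMap.lTensor_surjective R (g := f.restrictScalars k) hf

theorem Bm_exact (f : M' →ₗ[R] M) (g : M →ₗ[R] N) (h : Function.Exact f g)
    (hg : Function.Surjective g) : Function.Exact (Bm k R f) (Bm k R g) :=
  lTensor_exact R (f := f.restrictScalars k) (g := g.restrictScalars k) h hg

theorem Bm_comp (f : M' →ₗ[R] M) (g : M →ₗ[R] N) : Bm k R (g ∘ₗ f) = Bm k R g ∘ₗ Bm k R f := by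
  ext; simp [Bm]

theorem Bm_zero : Bm k R (0 : M →ₗ[R] N) = 0 := by
  ext; simp [Bm]

noncomputable def Omm (f : M →ₗ[R] N) : Om k R M →ₗ[R] Om k R N :=
  (Bm k R f).restrict (p := Om k R M) (q := Om k R N) (fun x hx => by
    rw [LinearMap.mem_ker] at *
    rw [act_Bm, hx, map_zero])

theorem Omm_coe (f : M →ₗ[R] N) (z : Om k R M) : (Omm k f z : R ⊗[k] N) = Bm k R f z := rfl

theorem Omm_inj (f : M →ₗ[R] N) (hf : Function.Injective f) : Function.Injective (Omm k f) := by
  intro x y h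
  exact Subtype.ext (Bm_inj k f hf (congrArg Subtype.val h))

theorem Omm_comp (f : M' →ₗ[R] M) (g : M →ₗ[R] N) : Omm k (g ∘ₗ f) = Omm k g ∘ₗ Omm k f := by
  apply LinearMap.ext; intro x; apply Subtype.ext
  simp [Omm_coe, Bm_comp]

theorem Omm_zero : Omm k (0 : M →ₗ[R] N) = 0 := by
  apply LinearMap.ext; intro x; apply Subtype.ext
  simp [Omm_coe, Bm_zero]

theorem Omm_surj (f : M' →ₗ[R] M) (g : M →ₗ[R] N) (h : Function.Exact f g)
    (hg : Function.Surjective g) : Function.Surjective (Omm k g) := by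
  rintro ⟨z, hz⟩
  obtain ⟨y, rfl⟩ := Bm_surj k g hg z
  rw [LinearMap.mem_ker, act_Bm] at hz
  obtain ⟨x, hx⟩ := (h _).1 hz
  have e : Bm k R f (1 ⊗ₜ x) = 1 ⊗ₜ f x := by simp [Bm]
  refine ⟨⟨y - Bm k R f (1 ⊗ₜ x), ?_⟩, ?_⟩
  · rw [LinearMap.mem_ker, map_sub, act_Bm, act_tmul, one_smul, hx, sub_self]
  · apply Subtype.ext
    rw [Omm_coe]
    simp [(Bm_exact k f g h hg).apply_apply_eq_zero]

theorem Omm_exact (f : M' →ₗ[R] M) (g : M →ₗ[R] N) (hf : Function.Injective f)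
    (h : Function.Exact f g)
    (hg : Function.Surjective g) : Function.Exact (Omm k f) (Omm k g) := by
  intro y
  constructor
  · intro hy
    obtain ⟨w, hw⟩ := (Bm_exact k f g h hg y).1 (congrArg Subtype.val hy)
    refine ⟨⟨w, ?_⟩, Subtype.ext hw⟩
    have h2 := y.2
    rw [LinearMap.mem_ker, ← hw, act_Bm] at h2
    rw [LinearMap.mem_ker]
    exact hf (h2.trans (map_zero f).symm)
  · rintro ⟨w, rfl⟩
    apply Subtype.ext
    exact (Bm_exact k f g h hg).apply_apply_eq_zero _

end maps

variable {R}

/-- Endomorphisms with a filtration on whose (finite projective dimension) quotients it is zero. -/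
inductive NilF (n : ℕ) : ∀ (M : Type u) [AddCommGroup M] [Module k M] [Module R M]
    [IsScalarTower k R M], (M →ₗ[R] M) → Prop
  | zero (M : Type u) [AddCommGroup M] [Module k M] [Module R M] [IsScalarTower k R M]
      (hfin : Module.Finite R M) (h : PD (R := R) (n + 1) M) : NilF n M 0
  | ext (M' M M'' : Type u) [AddCommGroup M'] [Module k M'] [Module R M'] [IsScalarTower k R M']
      [AddCommGroup M] [Module k M] [Module R M] [IsScalarTower k R M]
      [AddCommGroup M''] [Module k M''] [Module R M''] [IsScalarTower k R M'']
      (f' : M' →ₗ[R] M') (f : M →ₗ[R] M) (f'' : M'' →ₗ[R] M'')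
      (ι : M' →ₗ[R] M) (π : M →ₗ[R] M'') (hι : Function.Injective ι)
      (hπ : Function.Surjective π) (hex : Function.Exact ι π)
      (h1 : f ∘ₗ ι = ι ∘ₗ f') (h2 : π ∘ₗ f = f'' ∘ₗ π)
      (H' : NilF n M' f') (H'' : NilF n M'' f'') : NilF n M f

section nil
variable {k}
variable {M : Type u} [AddCommGroup M] [Module k M] [Module R M] [IsScalarTower k R M]

theorem NilF.mono {n m : ℕ} (h : n ≤ m) {f : M →ₗ[R] M} (H : NilF k n M f) : NilF k m M f := by
  induction H with
  | zero M hfin hp =>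
    exact .zero M hfin (hasProjectiveDimensionLT_of_ge _ (n + 1) (m + 1) (by omega))
  | ext M' M M'' f' f f'' ι π hι hπ hex h1 h2 _ _ i1 i2 =>
    exact .ext M' M M'' f' f f'' ι π hι hπ hex h1 h2 i1 i2

theorem NilF.finite {n : ℕ} {f : M →ₗ[R] M} (H : NilF k n M f) : Module.Finite R M := by
  induction H with
  | zero M hfin hp => exact hfin
  | ext M' M M'' f' f f'' ι π hι hπ hex h1 h2 _ _ i1 i2 => exact .of_exact hex hπ

theorem finite_k [FiniteDimensional k R] [Module.Finite R M] : Module.Finite k M :=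
  Module.Finite.trans R M

theorem finite_B [FiniteDimensional k R] [Module.Finite R M] : Module.Finite R (R ⊗[k] M) := by
  have : Module.Finite k M := finite_k (R := R)
  exact Module.Finite.of_restrictScalars_finite k R _

theorem finite_Om [FiniteDimensional k R] [Module.Finite R M] : Module.Finite R (Om k R M) := by
  have : Module.Finite k M := finite_k (R := R)
  have : Module.Finite k (Om k R M) :=
    inferInstanceAs (Module.Finite k ((Om k R M).restrictScalars k))
  exact Module.Finite.of_restrictScalars_finite k R _

theorem NilF.om [FiniteDimensional k R] {n : ℕ} {f : M →ₗ[R] M} (H : NilF k (n + 1) M f) :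
    NilF k n (Om k R M) (Omm k f) := by
  induction H with
  | zero M hfin hp =>
    rw [Omm_zero]
    exact .zero _ finite_Om ((PD_ker_iff _ (act_surj k R M) n).1 hp)
  | ext M' M M'' f' f f'' ι π hι hπ hex h1 h2 _ _ i1 i2 =>
    refine .ext _ _ _ _ _ _ (Omm k ι) (Omm k π) (Omm_inj k ι hι) (Omm_surj k ι π hex hπ)
      (Omm_exact k ι π hι hex hπ) ?_ ?_ i1 i2
    · rw [← Omm_comp, ← Omm_comp, h1]
    · rw [← Omm_comp, ← Omm_comp, h2]

theorem NilF.B [FiniteDimensional k R] {n : ℕ} {f : M →ₗ[R] M} (H : NilF k n M f) :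
    NilF k 0 (R ⊗[k] M) (Bm k R f) := by
  induction H with
  | zero M hfin hp =>
    rw [Bm_zero]
    exact .zero _ finite_B ((proj_iff _).2 inferInstance)
  | ext M' M M'' f' f f'' ι π hι hπ hex h1 h2 _ _ i1 i2 =>
    refine .ext _ _ _ _ _ _ (Bm k R ι) (Bm k R π) (Bm_inj k ι hι) (Bm_surj k π hπ)
      (Bm_exact k ι π hex hπ) ?_ ?_ i1 i2
    · rw [← Bm_comp, ← Bm_comp, h1]
    · rw [← Bm_comp, ← Bm_comp, h2]

variable {A : Type u} [AddCommGroup A] (t : R →+ A)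

theorem NilF.tr_zero0 (ht : ∀ a b, t (a * b) = t (b * a)) {f : M →ₗ[R] M} (H : NilF k 0 M f) :
    Module.Projective R M ∧
      ∀ [Module.Finite R M] [Module.Projective R M], tr t M f = 0 := by
  induction H with
  | zero M hfin hp => exact ⟨(proj_iff _).1 hp, tr_zero t⟩
  | ext M' M M'' f' f f'' ι π hι hπ hex h1 h2 H1 H2 i1 i2 =>
    obtain ⟨p1, i1⟩ := i1
    obtain ⟨p2, i2⟩ := i2
    have := H1.finite
    have := H2.finite
    have : Module.Projective R M := by
      obtain ⟨s, hs⟩ := Module.projective_lifting_property π LinearMap.id hπ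
      exact Module.Projective.of_equiv (hex.splitSurjectiveEquiv hι ⟨s, hs⟩).1.symm
    refine ⟨this, ?_⟩
    intro _ _
    rw [tr_exact t ht f' f f'' ι π hι hπ hex h1 h2, i1, i2, add_zero]

theorem NilF.tr_zero (ht : ∀ a b, t (a * b) = t (b * a)) [FiniteDimensional k R] (n : ℕ) :
    ∀ (M : Type u) [AddCommGroup M] [Module k M] [Module R M] [IsScalarTower k R M]
    (f : M →ₗ[R] M) (H : NilF k n M f) [Module.Finite R M] [Module.Projective R M],
    tr t M f = 0 := by
  induction n with
  | zero => intro M _ _ _ _ f H _ _; exact (H.tr_zero0 t ht).2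
  | succ n ih =>
    intro M _ _ _ _ f H _ hP
    have := finite_B (k := k) (R := R) (M := M)
    have := finite_Om (k := k) (R := R) (M := M)
    have : Module.Projective R (Om k R M) := by
      have h1 : PD (R := R) 1 M := (proj_iff M).2 hP
      refine (proj_iff _).1 ((PD_ker_iff _ (act_surj k R M) 0).1 ?_)
      exact hasProjectiveDimensionLT_of_ge _ 1 _ (by omega)
    have e := tr_exact (P' := Om k R M) (P := R ⊗[k] M) (P'' := M) t ht (Omm k f) (Bm k R f) f (Om k R M).subtype (act k R M)
      (Submodule.subtype_injective _) (act_surj k R M)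
      (LinearMap.exact_subtype_ker_map _) (by apply LinearMap.ext; intro x; rfl)
      (by apply LinearMap.ext; intro x; exact act_Bm k f x)
    rw [(H.B.tr_zero0 t ht).2, ih _ _ H.om, zero_add] at e
    exact e.symm

end nil

theorem exists_NilF (hpd : ∀ (M : Type u) [AddCommGroup M] [Module R M], Module.Finite R M →
      ∃ n, PD (R := R) (n + 1) M) [FiniteDimensional k R] (d : ℕ) :
    ∀ (M : Type u) [AddCommGroup M] [Module k M] [Module R M] [IsScalarTower k R M]
    (f : M →ₗ[R] M) [Module.Finite R M], f ^ d = 0 → ∃ n, NilF k n M f := by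
  induction d with
  | zero =>
    intro M _ _ _ _ f _ h
    obtain ⟨n, hn⟩ := hpd M inferInstance
    have : f = 0 := by rw [← mul_one f, ← pow_zero f, h, mul_zero]
    subst this
    exact ⟨n, .zero M inferInstance hn⟩
  | succ d ih =>
    intro M _ _ _ _ f _ h
    obtain ⟨n, hn⟩ := hpd (M ⧸ LinearMap.range f) inferInstance
    let f' : LinearMap.range f →ₗ[R] LinearMap.range f := f.restrict (fun x _ => ⟨x, rfl⟩)
    obtain ⟨n', hn'⟩ := ih (LinearMap.range f) f' (by
      have hpow : ∀ (d : ℕ) (z : LinearMap.range f), ((f' ^ d) z : M) = (f ^ d) (z : M) := by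
        intro d
        induction d with
        | zero => intro z; rfl
        | succ d ihd =>
          intro z
          rw [pow_succ, pow_succ, Module.End.mul_apply, Module.End.mul_apply, ihd]
          rfl
      apply LinearMap.ext
      intro z
      apply Subtype.ext
      rw [hpow]
      obtain ⟨y, hy⟩ := z.2
      have h2 := LinearMap.congr_fun h y
      rw [pow_succ, Module.End.mul_apply, hy] at h2
      exact h2)
    refine ⟨max n n', .ext (LinearMap.range f) M (M ⧸ LinearMap.range f) f' f 0
      (Submodule.subtype _) (Submodule.mkQ _) (Submodule.subtype_injective _)
      (Submodule.mkQ_surjective _) (LinearMap.exact_subtype_mkQ _) ?_ ?_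
      (hn'.mono (le_max_right _ _))
      ((NilF.zero _ inferInstance hn).mono (le_max_left _ _))⟩
    · ext; rfl
    · ext x; simp

theorem t_nilp [FiniteDimensional k R]
    (hpd : ∀ (M : Type u) [AddCommGroup M] [Module R M], Module.Finite R M →
      ∃ n, PD (R := R) (n + 1) M) {A : Type u} [AddCommGroup A] (t : R →+ A)
    (ht : ∀ a b, t (a * b) = t (b * a)) (a : R) (ha : IsNilpotent a) : t a = 0 := by
  obtain ⟨d, hd⟩ := ha
  let f : R →ₗ[R] R := LinearMap.toSpanSingleton R R a
  have hf : ∀ (d : ℕ) (x : R), (f ^ d) x = x * a ^ d := by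
    intro d
    induction d with
    | zero => simp
    | succ d ih => intro x; rw [pow_succ', pow_succ, Module.End.mul_apply, ih]; simp [f, mul_assoc]
  obtain ⟨n, hn⟩ := exists_NilF k hpd d R f (by ext; simp [hf, hd])
  have h0 := NilF.tr_zero t ht n R f hn
  let e : (Fin 1 → R) ≃ₗ[R] R := LinearEquiv.funUnique (Fin 1) R R
  rw [tr_eq t ht f e.toLinearMap e.symm.toLinearMap (by ext; simp)] at h0
  simpa [T0, e, f] using h0

end Bar

section Final

theorem semisimple_of_jac {R : Type u} [Ring R] [IsSemiprimaryRing R]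
    (M : Type u) [AddCommGroup M] [Module R M]
    (h : ∀ a ∈ Ring.jacobson R, ∀ m : M, a • m = 0) : IsSemisimpleModule R M := by
  have h : Module.IsTorsionBySet R M (Ring.jacobson R) := fun m a => h a.1 a.2 m
  let _ := h.module
  exact (h.semilinearMap.isSemisimpleModule_iff_of_bijective Function.bijective_id).2
      inferInstance

theorem final (k : Type u) [Field k] (R : Type u) [Ring R] [Algebra k R] [FiniteDimensional k R]
    (hpd : ∀ (M : Type u) [AddCommGroup M] [Module R M], Module.Finite R M →
      ∃ n, PD (R := R) (n + 1) M)
    (S E : Type u) [AddCommGroup S] [Module k S] [Module R S] [IsScalarTower k R S]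
    [AddCommGroup E] [Module k E] [Module R E] [IsScalarTower k R E]
    [IsSimpleModule R S] (x : S) (hx : ∀ y : S, ∃ c : k, y = c • x)
    (i : S →ₗ[R] E) (p : E →ₗ[R] S) (hi : Function.Injective i) (hp : Function.Surjective p)
    (hex : LinearMap.ker p = LinearMap.range i) :
    ∃ r : E →ₗ[R] S, ∀ x, r (i x) = x := by
  have hik (c : k) (y : S) : i (c • y) = c • i y := (i.restrictScalars k).map_smul c y
  have hpk (c : k) (y : E) : p (c • y) = c • p y := (p.restrictScalars k).map_smul c y
  have hx0 : x ≠ 0 := by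
    rintro rfl
    obtain ⟨y, hy⟩ := @exists_ne S (IsSimpleModule.nontrivial R S) 0
    obtain ⟨c, hc⟩ := hx y
    exact hy (by simpa using hc)
  have hw0 : i x ≠ 0 := fun h => hx0 (hi (h.trans (map_zero i).symm))
  choose χ hχ using fun r : R => hx (r • x)
  obtain ⟨e, he⟩ := hp x
  have key : ∀ y : E, ∃ a b : k, y = a • e + b • i x := by
    intro y
    obtain ⟨a, ha⟩ := hx (p y)
    have : y - a • e ∈ LinearMap.ker p := by
      rw [LinearMap.mem_ker, map_sub, hpk, he, ha, sub_self]
    rw [hex] at this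
    obtain ⟨z, hz⟩ := this
    obtain ⟨b, rfl⟩ := hx z
    refine ⟨a, b, ?_⟩
    rw [← hik, hz]; abel
  have key2 : ∀ r : R, ∃ b : k, r • e = χ r • e + b • i x := by
    intro r
    obtain ⟨a, b, h⟩ := key (r • e)
    have h2 : χ r = a := by
      have h3 := congrArg p h
      rw [map_add, map_smul, hpk, hpk, he, hχ,
        show p (i x) = 0 from (hex.symm ▸ ⟨x, rfl⟩ : i x ∈ LinearMap.ker p), smul_zero,
        add_zero] at h3
      exact smul_left_injective k hx0 h3
    exact ⟨b, h2 ▸ h⟩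
  choose δ hδ using key2
  have hχw (r : R) : r • i x = χ r • i x := by rw [← map_smul, hχ, hik]
  have χadd (r s : R) : χ (r + s) = χ r + χ s := smul_left_injective k hx0 (by
    simp only [← hχ, add_smul])
  have χmul (r s : R) : χ (r * s) = χ r * χ s := smul_left_injective k hx0 (by
    simp only
    rw [← hχ, mul_smul, hχ s, smul_comm, hχ r, smul_smul, mul_comm])
  have δadd (r s : R) : δ (r + s) = δ r + δ s := smul_left_injective k hw0 (by
    have h := hδ (r + s)
    rw [add_smul, hδ r, hδ s, χadd, add_smul] at h
    simp only [add_smul]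
    have h2 : χ r • e + χ s • e + (δ r • i x + δ s • i x) =
      χ r • e + χ s • e + δ (r + s) • i x := by rw [← h]; abel
    exact (add_left_cancel h2).symm)
  have δmul (r s : R) : δ (r * s) = χ r * δ s + χ s * δ r := smul_left_injective k hw0 (by
    have h := hδ (r * s)
    rw [mul_smul, hδ s, smul_add, smul_comm, hδ r, smul_comm r, hχw, χmul] at h
    have h2 : (χ r * χ s) • e + (χ r * δ s + χ s * δ r) • i x =
      (χ r * χ s) • e + δ (r * s) • i x := by rw [← h]; module
    exact (add_left_cancel h2).symm)
  let t : R →+ k := AddMonoidHom.mk' δ δadd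
  have hart : IsArtinianRing R := IsArtinianRing.of_finite k R
  have hE : IsSemisimpleModule R E := by
    apply semisimple_of_jac
    intro a ha y
    have hn : IsNilpotent a := by
      obtain ⟨n, hn⟩ := IsSemiprimaryRing.isNilpotent (R := R)
      refine ⟨n, ?_⟩
      have := Ideal.pow_mem_pow ha n
      rw [hn] at this
      exact this
    have hda : δ a = 0 := t_nilp k hpd t (fun r s => by
      change δ _ = δ _
      rw [δmul, δmul]; ring) a hn
    have hxa : χ a = 0 := smul_left_injective k hx0 (by
      simp only [zero_smul, ← hχ]
      exact Module.mem_annihilator.1 (IsSemisimpleModule.jacobson_le_annihilator R S ha) x)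
    obtain ⟨b, c, rfl⟩ := key y
    rw [smul_add, smul_comm, hδ, smul_comm, hχw, hda, hxa]
    simp
  obtain ⟨r, hr⟩ := IsSemisimpleModule.extension_property i hi LinearMap.id
  exact ⟨r, fun x => LinearMap.congr_fun hr x⟩

end Final

end NoLoop

/-- Let Λ be a finite dimensional elementary algebra over a field k (every simple right
Λ-module is one dimensional over k) of finite global dimension.  Then
Ext¹_Λ(S, S) = 0 for every simple right Λ-module S: the extension quiver of Λ has
no loops. -/
theorem no_loop_elementary (k : Type u) [Field k]
    (Λ : Type u) [Ring Λ] [Algebra k Λ] [FiniteDimensional k Λ]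
    (helem : ∀ (S : ModuleCat.{u} Λᵐᵒᵖ), IsSimpleModule Λᵐᵒᵖ S →
      ∃ x : S, ∀ y : S, ∃ c : k, y = (MulOpposite.op (algebraMap k Λ c)) • x)
    (hgl : ∀ (M : ModuleCat.{u} Λᵐᵒᵖ), Module.Finite Λᵐᵒᵖ M → FinProjDim Λ M) :
    ∀ (S : ModuleCat.{u} Λᵐᵒᵖ), IsSimpleModule Λᵐᵒᵖ S → Ext1SelfVanishes Λ S := by
  intro S hS E _ _ i p hi hp hex
  obtain ⟨x, hx⟩ := helem S hS
  have hpd : ∀ (M : Type u) [AddCommGroup M] [Module Λᵐᵒᵖ M], Module.Finite Λᵐᵒᵖ M →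
      ∃ n, NoLoop.PD (R := Λᵐᵒᵖ) (n + 1) M := by
    intro M _ _ hM
    obtain ⟨P, f, g, h1, h2, h3, h4, N, hN⟩ := hgl (ModuleCat.of Λᵐᵒᵖ M) hM
    exact ⟨N, NoLoop.PD_of_res N M P f g h1 h2 h3 h4 hN⟩
  letI : Module k S := Module.compHom S (algebraMap k Λᵐᵒᵖ)
  letI : Module k E := Module.compHom E (algebraMap k Λᵐᵒᵖ)
  haveI : IsScalarTower k Λᵐᵒᵖ S := .of_algebraMap_smul fun _ _ => rfl
  haveI : IsScalarTower k Λᵐᵒᵖ E := .of_algebraMap_smul fun _ _ => rfl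
  haveI : FiniteDimensional k Λᵐᵒᵖ :=
    Module.Finite.equiv (MulOpposite.opLinearEquiv k : Λ ≃ₗ[k] Λᵐᵒᵖ)
  exact NoLoop.final k Λᵐᵒᵖ hpd S E x hx i p hi hp hex
end
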